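/- arXiv:1611.06558 — 3 statements merged into one kernel-verified Lean document; each statement's English description precedes it below -/
import Mathlib

section
/- Let ψ ∈ 𝒯ₙ. For every pair of commuting families A = (A₁,…,Aₙ) and B = (B₁,…,Bₙ) from Gen(X)ⁿ such that D(Aᵢ) = D(Bᵢ) and Aᵢ − Bᵢ is a compact operator for each i = 1,…,n, the operator ψ(A) − ψ(B) is compact as well. -/
open MeasureTheory Complex ContinuousLinearMap

noncomputable section

/-- A generator of a uniformly bounded `C₀`-semigroup on a complex Banach space `X`,
bundled together with its semigroup `T`, its (maximal) domain `dom` and its action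
`gen` (extended by `0` outside of the domain). -/
structure GenOp (X : Type*) [NormedAddCommGroup X] [NormedSpace ℂ X] where
  T : ℝ → X →L[ℂ] X
  T_zero : T 0 = 1
  T_add : ∀ ⦃s t : ℝ⦄, 0 ≤ s → 0 ≤ t → T (s + t) = (T s).comp (T t)
  strong_cont : ∀ x : X, ContinuousOn (fun t => T t x) (Set.Ici 0)
  bounded : ∃ M : ℝ, ∀ t : ℝ, 0 ≤ t → ‖T t‖ ≤ M
  dom : Submodule ℂ X
  gen : X → X
  mem_dom_iff : ∀ x : X, x ∈ dom ↔ ∃ y : X,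
    Filter.Tendsto (fun t : ℝ => (t : ℂ)⁻¹ • (T t x - x)) (nhdsWithin 0 (Set.Ioi 0)) (nhds y)
  gen_spec : ∀ x ∈ dom,
    Filter.Tendsto (fun t : ℝ => (t : ℂ)⁻¹ • (T t x - x)) (nhdsWithin 0 (Set.Ioi 0))
      (nhds (gen x))
  gen_zero : ∀ x, x ∉ dom → gen x = 0

variable {X : Type*} [NormedAddCommGroup X] [NormedSpace ℂ X] [CompleteSpace X]

/-- Two semigroup generators commute if the corresponding semigroups commute. -/
def GenOp.Commutes (A B : GenOp X) : Prop :=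
  ∀ ⦃s t : ℝ⦄, 0 ≤ s → 0 ≤ t → (A.T s).comp (B.T t) = (B.T t).comp (A.T s)

/-- The `n`-parameter semigroup `T_A(u) = T_{A₁}(u₁) ⋯ T_{Aₙ}(uₙ)` associated with a
family `A = (A₁, …, Aₙ)` of semigroup generators. -/
def semigrProd {n : ℕ} (A : Fin n → GenOp X) (u : Fin n → ℝ) : X →L[ℂ] X :=
  (List.ofFn fun i => (A i).T (u i)).prod

/-- The representing measure of a Bernstein function `ψ ∈ 𝒯ₙ` with `c₀ = 0`, `c₁ = 0`
in its integral representation: a positive measure `μ` on `ℝ₊ⁿ \ {0}` such that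
`e^{s·u} - 1` is `μ`-integrable for every `s ∈ (-∞,0)ⁿ`.  The associated Bernstein
function is `ψ(s) = ∫ (e^{s·u} - 1) dμ(u)`, see `bPsi`. -/
structure BernsteinMeasure (n : ℕ) where
  μ : Measure (Fin n → ℝ)
  support : μ {u | ¬ ((∀ i, 0 ≤ u i) ∧ u ≠ 0)} = 0
  integrable : ∀ s : Fin n → ℝ, (∀ i, s i < 0) →
    Integrable (fun u => Real.exp (∑ i, s i * u i) - 1) μ

/-- The Bernstein function `ψ(s) = ∫ (e^{s·u} - 1) dμ(u)` of `n` variables associated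
with a representing measure `μ`. -/
def bPsi {n : ℕ} (ρ : BernsteinMeasure n) (s : Fin n → ℝ) : ℝ :=
  ∫ u, (Real.exp (∑ i, s i * u i) - 1) ∂ρ.μ

open Filter Topology Set in
theorem GenOp.jointCont (a : GenOp X) {M : ℝ} (hM : ∀ t : ℝ, 0 ≤ t → ‖a.T t‖ ≤ M) :
    ContinuousOn (fun p : ℝ × X => a.T p.1 p.2) (Ici 0 ×ˢ univ) := by
  apply continuousOn_prod_of_continuousOn_lipschitzOnWith' _ M.toNNReal
  · intro t ht
    refine LipschitzWith.lipschitzOnWith ?_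
    refine (a.T t).lipschitz.weaken ?_
    rw [← NNReal.coe_le_coe]
    exact (hM t ht).trans (Real.le_coe_toNNReal M)
  · intro x _
    exact a.strong_cont x

open Filter Topology Set in
theorem GenOp.dom_inv (a : GenOp X) {x : X} (hx : x ∈ a.dom) {s : ℝ} (hs : 0 ≤ s) :
    a.T s x ∈ a.dom := by
  rw [a.mem_dom_iff] at hx ⊢
  obtain ⟨y, hy⟩ := hx
  refine ⟨a.T s y, ?_⟩
  have h := ((a.T s).continuous.tendsto y).comp hy
  refine h.congr' ?_
  filter_upwards [self_mem_nhdsWithin] with t ht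
  have ht' : (0:ℝ) ≤ t := le_of_lt ht
  have : a.T s (a.T t x) = a.T t (a.T s x) := by
    have h1 := a.T_add hs ht'
    have h2 := a.T_add ht' hs
    rw [add_comm, h1] at h2
    exact congrArg (fun f : X →L[ℂ] X => f x) h2
  simp [this]

open Filter Topology Set in
theorem GenOp.tendsto_real (a : GenOp X) {x : X} (hx : x ∈ a.dom) :
    Tendsto (fun t : ℝ => t⁻¹ • (a.T t x - x)) (𝓝[>] 0) (𝓝 (a.gen x)) := by
  refine (a.gen_spec x hx).congr fun t => ?_
  rw [← Complex.ofReal_inv, Complex.coe_smul]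

open Filter Topology Set in
theorem duhamel (a b : GenOp X) {Ma Mb : ℝ} (hMa : ∀ t : ℝ, 0 ≤ t → ‖a.T t‖ ≤ Ma)
    (hMb : ∀ t : ℝ, 0 ≤ t → ‖b.T t‖ ≤ Mb) (hdom : a.dom = b.dom) (D : X →L[ℂ] X)
    (hD : ∀ x ∈ a.dom, D x = a.gen x - b.gen x) {t : ℝ} (ht : 0 ≤ t) {x : X} (hx : x ∈ a.dom) :
    IntervalIntegrable (fun s => a.T (t - s) (D (b.T s x))) volume 0 t ∧
    ∫ s in (0:ℝ)..t, a.T (t - s) (D (b.T s x)) = a.T t x - b.T t x := by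
  have hJ := a.jointCont hMa
  have hc : ContinuousOn (fun s => b.T s x) (Icc 0 t) :=
    (b.strong_cont x).mono fun s hs => hs.1
  have hcont' : ContinuousOn (fun s => a.T (t - s) (D (b.T s x))) (Icc 0 t) := by
    refine hJ.comp (f := fun s => (t - s, D (b.T s x))) ?_ ?_
    · exact (continuousOn_const.sub continuousOn_id).prodMk (D.continuous.comp_continuousOn hc)
    · intro s hs; exact ⟨by simpa using hs.2, mem_univ _⟩
  have hcont : ContinuousOn (fun s => a.T (t - s) (b.T s x)) (Icc 0 t) := by
    refine hJ.comp (f := fun s => (t - s, b.T s x)) ?_ ?_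
    · exact (continuousOn_const.sub continuousOn_id).prodMk hc
    · intro s hs; exact ⟨by simpa using hs.2, mem_univ _⟩
  have hint : IntervalIntegrable (fun s => a.T (t - s) (D (b.T s x))) volume 0 t := by
    apply ContinuousOn.intervalIntegrable
    rwa [uIcc_of_le ht]
  refine ⟨hint, ?_⟩
  have key := intervalIntegral.integral_eq_sub_of_hasDeriv_right_of_le ht hcont
    (f' := fun s => - (a.T (t - s) (D (b.T s x)))) ?_ hint.neg
  · rw [intervalIntegral.integral_neg] at key
    simp only [sub_self, sub_zero, a.T_zero, b.T_zero, one_apply_eq_self] at key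
    rw [← neg_inj, key]; abel
  · intro s hs
    rw [hasDerivWithinAt_iff_tendsto_slope' (by simp)]
    set y := b.T s x with hy
    have hyb : y ∈ b.dom := b.dom_inv (hdom ▸ hx) hs.1.le
    have hya : y ∈ a.dom := hdom ▸ hyb
    have hsub : Tendsto (fun z : ℝ => z - s) (𝓝[>] s) (𝓝[>] 0) := by
      refine tendsto_nhdsWithin_iff.2 ⟨?_, ?_⟩
      · have : Tendsto (fun z : ℝ => z - s) (𝓝 s) (𝓝 (s - s)) :=
          (continuous_id.sub continuous_const).tendsto s
        rw [sub_self] at this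
        exact this.mono_left nhdsWithin_le_nhds
      · filter_upwards [self_mem_nhdsWithin] with z hz
        simpa using hz
    have h1 := ((b.tendsto_real hyb).sub (a.tendsto_real hya)).comp hsub
    have h2 : b.gen y - a.gen y = - D y := by rw [hD y hya]; abel
    rw [h2] at h1
    have h3 : Tendsto (fun z : ℝ => t - z) (𝓝[>] s) (𝓝 (t - s)) :=
      ((continuous_const.sub continuous_id).tendsto s).mono_left nhdsWithin_le_nhds
    have hlt : ∀ᶠ z in 𝓝[>] s, z < t :=
      nhdsWithin_le_nhds (Iio_mem_nhds hs.2)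
    have h4 := (hJ (t - s, - D y) ⟨by simpa using hs.2.le, mem_univ _⟩).tendsto.comp
      (tendsto_nhdsWithin_iff.2 ⟨h3.prodMk_nhds h1, by
        filter_upwards [hlt] with z hz
        exact ⟨by simpa using hz.le, mem_univ _⟩⟩)
    have h5 : a.T (t - s) (- D y) = -(a.T (t - s) (D y)) := map_neg _ _
    simp only [h5] at h4
    refine h4.congr' ?_
    filter_upwards [hlt, self_mem_nhdsWithin] with z hz hzs
    have hzs' : 0 ≤ z - s := by have : s < z := hzs; linarith
    have e1 : b.T z x = b.T (z - s) y := by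
      have := b.T_add hzs' hs.1.le
      rw [sub_add_cancel] at this
      rw [this]; rfl
    have e2 : a.T (t - s) y = a.T (t - z) (a.T (z - s) y) := by
      have := a.T_add (sub_nonneg.2 hz.le) hzs'
      rw [sub_add_sub_cancel] at this
      rw [this]; rfl
    simp only [Function.comp, slope, vsub_eq_sub]
    rw [e1, ← hy, e2, ← smul_sub, ← map_sub, ← ContinuousLinearMap.map_smul_of_tower]
    congr 2
    abel

open Filter Topology Set in
theorem G_bound (a b : GenOp X) {Ma Mb : ℝ} (hMa : ∀ t : ℝ, 0 ≤ t → ‖a.T t‖ ≤ Ma)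
    (hMb : ∀ t : ℝ, 0 ≤ t → ‖b.T t‖ ≤ Mb) (hdom : a.dom = b.dom) (hdense : Dense (a.dom : Set X))
    (D : X →L[ℂ] X)
    (hD : ∀ x ∈ a.dom, D x = a.gen x - b.gen x) {t : ℝ} (ht : 0 ≤ t) :
    ‖a.T t - b.T t‖ ≤ Ma * ‖D‖ * Mb * t := by
  have hMa0 : 0 ≤ Ma := (norm_nonneg _).trans (hMa 0 le_rfl)
  have hMb0 : 0 ≤ Mb := (norm_nonneg _).trans (hMb 0 le_rfl)
  refine ContinuousLinearMap.opNorm_le_bound _ (by positivity) fun x => ?_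
  have hcl : IsClosed {x : X | ‖(a.T t - b.T t) x‖ ≤ Ma * ‖D‖ * Mb * t * ‖x‖} :=
    isClosed_le (by fun_prop) (by fun_prop)
  refine hcl.closure_subset_iff.2 ?_ (hdense x)
  intro x hx
  obtain ⟨_, h⟩ := duhamel a b hMa hMb hdom D hD ht hx
  simp only [mem_ofPred_eq, sub_apply]
  rw [← h]
  have := intervalIntegral.norm_integral_le_of_norm_le_const (a := (0:ℝ)) (b := t)
    (f := fun s => a.T (t - s) (D (b.T s x))) (C := Ma * (‖D‖ * (Mb * ‖x‖))) (by
      intro s hs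
      rw [uIoc_of_le ht] at hs
      refine (ContinuousLinearMap.le_of_opNorm_le _ (hMa _ (by linarith [hs.2])) _).trans ?_
      gcongr
      refine (D.le_opNorm _).trans ?_
      gcongr
      exact ContinuousLinearMap.le_of_opNorm_le _ (hMb _ hs.1.le) _)
  refine this.trans_eq ?_
  rw [sub_zero, abs_of_nonneg ht]; ring

open Filter Topology Set in
theorem G_compact (a b : GenOp X) {Ma Mb : ℝ} (hMa : ∀ t : ℝ, 0 ≤ t → ‖a.T t‖ ≤ Ma)
    (hMb : ∀ t : ℝ, 0 ≤ t → ‖b.T t‖ ≤ Mb) (hdom : a.dom = b.dom) (hdense : Dense (a.dom : Set X))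
    (D : X →L[ℂ] X)
    (hD : ∀ x ∈ a.dom, D x = a.gen x - b.gen x) (hDc : IsCompactOperator D) {t : ℝ} (ht : 0 ≤ t) :
    IsCompactOperator (a.T t - b.T t) := by
  have hMb0 : 0 ≤ Mb := (norm_nonneg _).trans (hMb 0 le_rfl)
  rcases ht.eq_or_lt with rfl | htp
  · rw [a.T_zero, b.T_zero, sub_self]; exact isCompactOperator_zero
  have hK0 : IsCompact (closure (D '' Metric.closedBall 0 Mb)) :=
    IsCompactOperator.isCompact_closure_image_closedBall (f := (D : X →ₗ[ℂ] X)) hDc Mb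
  set K := (fun p : ℝ × X => a.T p.1 p.2) '' (Icc 0 t ×ˢ closure (D '' Metric.closedBall 0 Mb))
    with hK
  have hKc : IsCompact K := by
    refine (isCompact_Icc.prod hK0).image_of_continuousOn ((a.jointCont hMa).mono ?_)
    exact prod_mono (fun s hs => hs.1) (subset_univ _)
  have hKh : IsCompact (closure (convexHull ℝ K)) := by
    exact isCompact_iff_totallyBounded_isComplete.2
      ⟨(totallyBounded_convexHull.2 hKc.totallyBounded).closure, isClosed_closure.isComplete⟩
  set K' := (fun z : X => t • z) '' closure (convexHull ℝ K) with hK'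
  have hKc' : IsCompact K' := hKh.image (continuous_const_smul t)
  have hsub : (a.T t - b.T t) '' Metric.ball 0 1 ⊆ K' := by
    rintro _ ⟨x, hx, rfl⟩
    have hcl : IsClosed {x : X | (a.T t - b.T t) x ∈ K'} :=
      hKc'.isClosed.preimage (a.T t - b.T t).continuous
    refine hcl.closure_subset_iff.2 ?_ (hdense.open_subset_closure_inter Metric.isOpen_ball hx)
    rintro x ⟨hxb, hx⟩
    obtain ⟨hi, h⟩ := duhamel a b hMa hMb hdom D hD ht hx
    have havg := (convex_convexHull ℝ K).set_average_mem_closure (μ := volume) (t := Ioc 0 t)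
      (f := fun s => a.T (t - s) (D (b.T s x))) (by simpa using htp) (by simp) (by
        refine (ae_restrict_mem measurableSet_Ioc).mono fun s hs => ?_
        refine subset_convexHull ℝ K ⟨(t - s, D (b.T s x)), ⟨⟨by linarith [hs.2], by linarith [hs.1]⟩, ?_⟩, rfl⟩
        refine subset_closure ⟨_, ?_, rfl⟩
        rw [mem_closedBall_zero_iff]
        refine (ContinuousLinearMap.le_of_opNorm_le _ (hMb _ hs.1.le) _).trans ?_
        have : ‖x‖ ≤ 1 := (mem_ball_zero_iff.1 hxb).le
        nlinarith) ((intervalIntegrable_iff_integrableOn_Ioc_of_le ht).1 hi)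
    refine ⟨_, havg, ?_⟩
    simp only [setAverage_eq, sub_apply]
    rw [← h, intervalIntegral.integral_of_le ht, smul_smul]
    simp [measureReal_def, ht, htp.ne']
  exact (isCompactOperator_iff_image_ball_subset_compact
    ((a.T t - b.T t : X →L[ℂ] X) : X →ₗ[ℂ] X) one_pos).2 ⟨K', hKc', hsub⟩

theorem semigrProd_succ {n : ℕ} (A : Fin (n+1) → GenOp X) (u : Fin (n+1) → ℝ) :
    semigrProd A u = (A 0).T (u 0) * semigrProd (fun i => A i.succ) (fun i => u i.succ) := by
  simp [semigrProd, List.ofFn_succ]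

theorem semigrProd_norm {n : ℕ} (A : Fin n → GenOp X) {M : ℝ} (hM0 : 0 ≤ M)
    (hM : ∀ i, ∀ t : ℝ, 0 ≤ t → ‖(A i).T t‖ ≤ M) (u : Fin n → ℝ) (hu : ∀ i, 0 ≤ u i) :
    ‖semigrProd A u‖ ≤ M ^ n := by
  induction n with
  | zero => 
    have : semigrProd A u = ContinuousLinearMap.id ℂ X := by simp [semigrProd]; rfl
    rw [this, pow_zero]
    exact ContinuousLinearMap.norm_id_le
  | succ n ih =>
    rw [semigrProd_succ, pow_succ']
    refine (norm_mul_le _ _).trans ?_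
    exact mul_le_mul (hM 0 _ (hu 0)) (ih _ (fun i => hM i.succ) _ (fun i => hu i.succ))
      (norm_nonneg _) hM0

theorem semigrProd_commute {n : ℕ} (a : GenOp X) (A : Fin n → GenOp X)
    (h : ∀ i, a.Commutes (A i)) {t : ℝ} (ht : 0 ≤ t) (u : Fin n → ℝ) (hu : ∀ i, 0 ≤ u i) :
    a.T t * semigrProd A u = semigrProd A u * a.T t := by
  induction n with
  | zero => simp [semigrProd]
  | succ n ih =>
    have h1 : a.T t * (A 0).T (u 0) = (A 0).T (u 0) * a.T t := h 0 ht (hu 0)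
    rw [semigrProd_succ, ← mul_assoc, h1, mul_assoc,
      ih _ (fun i => h i.succ) _ (fun i => hu i.succ), mul_assoc]

theorem semigrProd_add {n : ℕ} (A : Fin n → GenOp X)
    (hc : ∀ i j, (A i).Commutes (A j)) (h u : Fin n → ℝ) (hh : ∀ i, 0 ≤ h i) (hu : ∀ i, 0 ≤ u i) :
    semigrProd A (h + u) = semigrProd A h * semigrProd A u := by
  induction n with
  | zero => simp [semigrProd]
  | succ n ih =>
    have e1 : (A 0).T ((h + u) 0) = (A 0).T (h 0) * (A 0).T (u 0) := (A 0).T_add (hh 0) (hu 0)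
    have e2 := ih (fun i => A i.succ) (fun i j => hc _ _) (fun i => h i.succ) (fun i => u i.succ)
      (fun i => hh _) (fun i => hu _)
    have e3 := semigrProd_commute (A 0) (fun i => A i.succ) (fun i => hc _ _) (hu 0)
      (fun i => h i.succ) (fun i => hh _)
    have e4 : (fun i : Fin n => (h + u) i.succ) = (fun i => h i.succ) + (fun i => u i.succ) := rfl
    rw [semigrProd_succ, semigrProd_succ, semigrProd_succ, e1, e4, e2]
    simp only [mul_assoc]
    congr 1
    rw [← mul_assoc, e3, mul_assoc]

open Filter Topology Set in
theorem semigrProd_tendsto {n : ℕ} (A : Fin n → GenOp X) {M : ℝ}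
    (hM : ∀ i, ∀ t : ℝ, 0 ≤ t → ‖(A i).T t‖ ≤ M) {ι : Type*} {l : Filter ι}
    (h : ι → Fin n → ℝ) (hh : ∀ k i, 0 ≤ h k i) (hl : ∀ i, Tendsto (fun k => h k i) l (𝓝 0))
    (y : X) : Tendsto (fun k => semigrProd A (h k) y) l (𝓝 y) := by
  induction n with
  | zero => simp [semigrProd, tendsto_const_nhds]
  | succ n ih =>
    have h1 := ih (fun i => A i.succ) (fun i => hM _) (fun k i => h k i.succ) (fun k i => hh _ _)
      (fun i => hl _)
    have h2 := ((A 0).jointCont (hM 0) (0, y) ⟨self_mem_Ici, mem_univ _⟩).tendsto.comp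
      (tendsto_nhdsWithin_iff.2 ⟨(hl 0).prodMk_nhds h1,
        Eventually.of_forall fun k => ⟨hh k 0, mem_univ _⟩⟩)
    simp only [(A 0).T_zero, one_apply_eq_self] at h2
    refine h2.congr fun k => ?_
    rw [semigrProd_succ]; rfl

theorem F_bound {n : ℕ} (A B : Fin n → GenOp X) {MA MB : ℝ} (hMA0 : 0 ≤ MA) (hMB0 : 0 ≤ MB)
    (hMA : ∀ i, ∀ t : ℝ, 0 ≤ t → ‖(A i).T t‖ ≤ MA)
    (hMB : ∀ i, ∀ t : ℝ, 0 ≤ t → ‖(B i).T t‖ ≤ MB)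
    (hdom : ∀ i, (A i).dom = (B i).dom)
    (hdense : ∀ i, Dense ((A i).dom : Set X))
    (D : Fin n → (X →L[ℂ] X))
    (hD : ∀ i, ∀ x ∈ (A i).dom, D i x = (A i).gen x - (B i).gen x)
    (hDcpt : ∀ i, IsCompactOperator (D i)) :
    ∃ C : ℝ, 0 ≤ C ∧ ∀ u : Fin n → ℝ, (∀ i, 0 ≤ u i) →
      ‖semigrProd A u - semigrProd B u‖ ≤ C * ∑ i, u i ∧
      IsCompactOperator (semigrProd A u - semigrProd B u) := by
  induction n with
  | zero =>
    refine ⟨0, le_rfl, fun u _ => ⟨by simp [semigrProd], ?_⟩⟩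
    have : semigrProd A u - semigrProd B u = 0 := by simp [semigrProd]
    rw [this]; exact isCompactOperator_zero
  | succ n ih =>
    obtain ⟨C, hC0, hC⟩ := ih (fun i => A i.succ) (fun i => B i.succ) (fun i => hMA _)
      (fun i => hMB _) (fun i => hdom _) (fun i => hdense _) (fun i => D i.succ)
      (fun i => hD _) (fun i => hDcpt _)
    refine ⟨MA * ‖D 0‖ * MB * MB ^ n + MA * C, by positivity, fun u hu => ?_⟩
    obtain ⟨hC1, hC2⟩ := hC (fun i => u i.succ) (fun i => hu _)
    have hP := semigrProd_norm (fun i => B i.succ) hMB0 (fun i => hMB _) (fun i => u i.succ)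
      (fun i => hu _)
    have g1 := G_bound (A 0) (B 0) (hMA 0) (hMB 0) (hdom 0) (hdense 0) (D 0) (hD 0) (hu 0)
    have g2 := G_compact (A 0) (B 0) (hMA 0) (hMB 0) (hdom 0) (hdense 0) (D 0) (hD 0) (hDcpt 0)
      (hu 0)
    set PA := semigrProd (fun i => A i.succ) (fun i => u i.succ)
    set PB := semigrProd (fun i => B i.succ) (fun i => u i.succ)
    have e : semigrProd A u - semigrProd B u =
        ((A 0).T (u 0) - (B 0).T (u 0)) * PB + (A 0).T (u 0) * (PA - PB) := by
      rw [semigrProd_succ, semigrProd_succ]; noncomm_ring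
    have hs0 : 0 ≤ ∑ i : Fin n, u i.succ := Finset.sum_nonneg fun i _ => hu _
    constructor
    · rw [e, Fin.sum_univ_succ]
      refine (norm_add_le _ _).trans ?_
      have b1 : ‖((A 0).T (u 0) - (B 0).T (u 0)) * PB‖ ≤ (MA * ‖D 0‖ * MB * u 0) * MB ^ n :=
        (norm_mul_le _ _).trans (mul_le_mul g1 hP (norm_nonneg _)
          (mul_nonneg (by positivity) (hu 0)))
      have b2 : ‖(A 0).T (u 0) * (PA - PB)‖ ≤ MA * (C * ∑ i : Fin n, u i.succ) :=
        (norm_mul_le _ _).trans (mul_le_mul (hMA 0 _ (hu 0)) hC1 (norm_nonneg _) hMA0)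
      have b3 : 0 ≤ MA * ‖D 0‖ * MB * MB ^ n * ∑ i : Fin n, u i.succ := by positivity
      have b4 : 0 ≤ MA * C * u 0 := mul_nonneg (by positivity) (hu 0)
      nlinarith
    · rw [e]
      exact (g2.comp_clm PB).add (hC2.clm_comp ((A 0).T (u 0)))

open Filter Topology Set in
theorem compact_tendsto {ι : Type*} {l : Filter ι} (T : ι → X →L[ℂ] X) {M : ℝ}
    (hM : ∀ k, ‖T k‖ ≤ M) (hT : ∀ y, Tendsto (fun k => T k y) l (𝓝 y)) (K : X →L[ℂ] X)
    (hK : IsCompactOperator K) : Tendsto (fun k => T k * K) l (𝓝 K) := by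
  by_cases hl : l.NeBot
  swap
  · rw [not_neBot] at hl; simp [hl]
  obtain ⟨k0⟩ : Nonempty ι := hl.nonempty
  have hM0 : 0 ≤ M := (norm_nonneg _).trans (hM k0)
  rw [Metric.tendsto_nhds]
  intro ε hε
  set δ := ε / (2 * (M + 2)) with hδ
  have hδ0 : 0 < δ := by positivity
  have hc : TotallyBounded (K '' Metric.closedBall 0 1) :=
    (IsCompactOperator.isCompact_closure_image_closedBall
      (f := (K : X →ₗ[ℂ] X)) hK 1).totallyBounded.subset subset_closure
  obtain ⟨s, hsf, hs⟩ := Metric.totallyBounded_iff.1 hc δ hδ0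
  have hev : ∀ᶠ k in l, ∀ y ∈ s, dist (T k y) y < δ :=
    (hsf.eventually_all).2 fun y _ => Metric.tendsto_nhds.1 (hT y) δ hδ0
  filter_upwards [hev] with k hk
  rw [dist_eq_norm]
  refine lt_of_le_of_lt (b := ε / 2) ?_ (by linarith)
  have hb : ∀ x : X, ‖x‖ ≤ 1 → ‖(T k * K - K) x‖ ≤ ε / 2 := by
    intro x hx
    have hx' : K x ∈ K '' Metric.closedBall 0 1 := ⟨x, by simpa using hx, rfl⟩
    obtain ⟨y, hy, hxy⟩ := mem_iUnion₂.1 (hs hx')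
    have h1 : ‖K x - y‖ ≤ δ := by rw [← dist_eq_norm]; exact (Metric.mem_ball.1 hxy).le
    have h2 : ‖T k y - y‖ ≤ δ := by rw [← dist_eq_norm]; exact (hk y hy).le
    have h3 : ‖T k (K x - y)‖ ≤ M * δ :=
      (ContinuousLinearMap.le_of_opNorm_le _ (hM k) _).trans (by gcongr)
    have e : (T k * K - K) x = T k (K x - y) + (T k y - y) - (K x - y) := by
      rw [map_sub]
      change T k (K x) - K x = _
      abel
    rw [e]
    refine (norm_sub_le _ _).trans ?_
    have h4 := norm_add_le (T k (K x - y)) (T k y - y)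
    have h5 : M * δ + δ + δ = ε / 2 := by rw [hδ]; field_simp; ring
    linarith
  refine ContinuousLinearMap.opNorm_le_bound _ (by positivity) fun x => ?_
  rcases eq_or_ne x 0 with rfl | hx
  · simp
  have hx0 : 0 < ‖x‖ := norm_pos_iff.2 hx
  have hz := hb (((‖x‖⁻¹ : ℝ) : ℂ) • x) (by
    rw [norm_smul, Complex.norm_real, norm_inv, norm_norm, inv_mul_cancel₀ hx0.ne'])
  rw [map_smul, norm_smul, Complex.norm_real, norm_inv, norm_norm, inv_mul_le_iff₀ hx0] at hz
  linarith

theorem integral_mem_closed {E : Type*} [NormedAddCommGroup E] [NormedSpace ℂ E] [CompleteSpace E]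
    {Ω : Type*} [MeasurableSpace Ω] {μ : Measure Ω} (V : Submodule ℂ E) (hV : IsClosed (V : Set E))
    (F : Ω → E) (hF : Integrable F μ) (hc : ∀ᵐ u ∂μ, F u ∈ V) : ∫ u, F u ∂μ ∈ V := by
  have : IsClosed (V : Set E) := hV
  let q : E →L[ℂ] E ⧸ V := V.mkQ.mkContinuous 1 (fun x => by
    simpa using Submodule.Quotient.norm_mk_le V x)
  have h := q.integral_comp_comm hF
  have h0 : ∫ u, q (F u) ∂μ = 0 := by
    refine integral_eq_zero_of_ae (hc.mono fun u hu => ?_)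
    exact (Submodule.Quotient.mk_eq_zero V).2 hu
  rw [h0] at h
  exact (Submodule.Quotient.mk_eq_zero V).1 h.symm

theorem integral_compact {Ω : Type*} [MeasurableSpace Ω] {μ : Measure Ω} (F : Ω → X →L[ℂ] X)
    (hF : Integrable F μ) (hc : ∀ᵐ u ∂μ, IsCompactOperator (F u)) :
    IsCompactOperator (∫ u, F u ∂μ : X →L[ℂ] X) :=
  integral_mem_closed (compactOperator (RingHom.id ℂ) X X) isClosed_setOfPred_isCompactOperator
    F hF hc

open Filter Topology Set in
theorem F_meas {n : ℕ} {μ : Measure (Fin n → ℝ)} (A B : Fin n → GenOp X) {MA MB C : ℝ}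
    (hMA0 : 0 ≤ MA) (hMB0 : 0 ≤ MB)
    (hMA : ∀ i, ∀ t : ℝ, 0 ≤ t → ‖(A i).T t‖ ≤ MA)
    (hMB : ∀ i, ∀ t : ℝ, 0 ≤ t → ‖(B i).T t‖ ≤ MB)
    (hAcomm : ∀ i j, (A i).Commutes (A j)) (hBcomm : ∀ i j, (B i).Commutes (B j))
    (hC : ∀ u : Fin n → ℝ, (∀ i, 0 ≤ u i) →
      ‖semigrProd A u - semigrProd B u‖ ≤ C * ∑ i, u i ∧
      IsCompactOperator (semigrProd A u - semigrProd B u))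
    (hpos : ∀ᵐ u ∂μ, ∀ i, 0 ≤ u i) :
    AEStronglyMeasurable (fun u => semigrProd A u - semigrProd B u) μ := by
  set F : (Fin n → ℝ) → X →L[ℂ] X := fun u => semigrProd A u - semigrProd B u with hF
  refine aestronglyMeasurable_of_tendsto_ae (atTop : Filter ℕ)
    (f := fun k u => F (fun i => (⌈((k : ℝ) + 1) * u i⌉ : ℝ) / ((k : ℝ) + 1))) ?_ ?_
  · intro k
    have h1 : StronglyMeasurable
        (fun z : Fin n → ℤ => F (fun i => (z i : ℝ) / ((k : ℝ) + 1))) :=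
      StronglyMeasurable.of_discrete
    have h2 : Measurable (fun u : Fin n → ℝ => fun i => ⌈((k : ℝ) + 1) * u i⌉) :=
      measurable_pi_lambda _ fun i => Int.measurable_ceil.comp
        ((measurable_pi_apply i).const_mul _)
    exact (h1.comp_measurable h2).aestronglyMeasurable
  · filter_upwards [hpos] with u hu
    set h : ℕ → Fin n → ℝ :=
      fun k i => (⌈((k : ℝ) + 1) * u i⌉ : ℝ) / ((k : ℝ) + 1) - u i with hh
    have hk0 : ∀ k : ℕ, (0 : ℝ) < (k : ℝ) + 1 := fun k => by positivity
    have hh0 : ∀ k i, 0 ≤ h k i := by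
      intro k i
      simp only [hh]
      rw [sub_nonneg, le_div_iff₀ (hk0 k), mul_comm]
      exact Int.le_ceil _
    have hh1 : ∀ k i, h k i ≤ 1 / ((k : ℝ) + 1) := by
      intro k i
      simp only [hh]
      rw [sub_le_iff_le_add, div_le_iff₀ (hk0 k), add_mul (1 / ((k : ℝ) + 1)),
        one_div, inv_mul_cancel₀ (hk0 k).ne']
      have := (Int.ceil_lt_add_one (((k : ℝ) + 1) * u i)).le
      linarith
    have hl : ∀ i, Tendsto (fun k => h k i) atTop (𝓝 0) := fun i =>
      squeeze_zero (fun k => hh0 k i) (fun k => hh1 k i) tendsto_one_div_add_atTop_nhds_zero_nat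
    have e : ∀ k : ℕ, F (fun i => (⌈((k : ℝ) + 1) * u i⌉ : ℝ) / ((k : ℝ) + 1)) =
        semigrProd A (h k) * F u + F (h k) * semigrProd B u := by
      intro k
      have : (fun i => (⌈((k : ℝ) + 1) * u i⌉ : ℝ) / ((k : ℝ) + 1)) = h k + u := by
        funext i; simp [hh]
      rw [this]
      simp only [hF]
      rw [semigrProd_add A hAcomm _ _ (hh0 k) hu, semigrProd_add B hBcomm _ _ (hh0 k) hu]
      noncomm_ring
    simp only [e]
    have t1 : Tendsto (fun k => semigrProd A (h k) * F u) atTop (𝓝 (F u)) :=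
      compact_tendsto _ (fun k => semigrProd_norm A hMA0 hMA (h k) (hh0 k))
        (semigrProd_tendsto A hMA h hh0 hl) _ (hC u hu).2
    have t2 : Tendsto (fun k => F (h k)) atTop (𝓝 0) := by
      refine squeeze_zero_norm (fun k => (hC (h k) (hh0 k)).1) ?_
      have := (tendsto_finsetSum Finset.univ fun i _ => hl i).const_mul C
      simpa using this
    have t3 := t1.add (t2.mul_const (semigrProd B u))
    simpa using t3

/-- **Corollary 6.** Let `ψ ∈ 𝒯ₙ`.  For commuting families `A`, `B` from `Gen(X)ⁿ` with
`D(Aᵢ) = D(Bᵢ)` and `Aᵢ - Bᵢ` compact, the (bounded) operator `ψ(A) - ψ(B)` is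
compact as well. -/
theorem bernstein_perturbation_compact {n : ℕ} (hn : 0 < n) (ρ : BernsteinMeasure n)
    (A B : Fin n → GenOp X)
    (hAcomm : ∀ i j, (A i).Commutes (A j)) (hBcomm : ∀ i j, (B i).Commutes (B j))
    (MA MB : ℝ)
    (hMA : ∀ i, ∀ t : ℝ, 0 ≤ t → ‖(A i).T t‖ ≤ MA)
    (hMB : ∀ i, ∀ t : ℝ, 0 ≤ t → ‖(B i).T t‖ ≤ MB)
    (hdom : ∀ i, (A i).dom = (B i).dom)
    (hdense : ∀ i, Dense ((A i).dom : Set X))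
    (D : Fin n → (X →L[ℂ] X))
    (hD : ∀ i, ∀ x ∈ (A i).dom, D i x = (A i).gen x - (B i).gen x)
    (hDcpt : ∀ i, IsCompactOperator (D i)) :
    ∃ S : X →L[ℂ] X,
      (∀ x ∈ ⨅ i, (A i).dom, S x = ∫ u, (semigrProd A u x - semigrProd B u x) ∂ρ.μ) ∧
      IsCompactOperator S := by
  have hMA0 : 0 ≤ MA := (norm_nonneg _).trans (hMA ⟨0, hn⟩ 0 le_rfl)
  have hMB0 : 0 ≤ MB := (norm_nonneg _).trans (hMB ⟨0, hn⟩ 0 le_rfl)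
  obtain ⟨C, hC0, hC⟩ := F_bound A B hMA0 hMB0 hMA hMB hdom hdense D hD hDcpt
  have hpos : ∀ᵐ u ∂ρ.μ, ∀ i, 0 ≤ u i := by
    have h : ∀ᵐ u ∂ρ.μ, (∀ i, 0 ≤ u i) ∧ u ≠ 0 := ρ.support
    exact h.mono fun u hu => hu.1
  have hmeas := F_meas A B hMA0 hMB0 hMA hMB hAcomm hBcomm hC hpos
  have hint : Integrable (fun u => semigrProd A u - semigrProd B u) ρ.μ := by
    have hI := (ρ.integrable (fun _ => -1) (fun _ => by norm_num)).const_mul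
      (-(2 * (C + MA ^ n + MB ^ n)))
    refine hI.mono' hmeas ?_
    filter_upwards [hpos] with u hu
    have hs0 : 0 ≤ ∑ i, u i := Finset.sum_nonneg fun i _ => hu i
    have b1 := (hC u hu).1
    have b2 : ‖semigrProd A u - semigrProd B u‖ ≤ MA ^ n + MB ^ n :=
      (norm_sub_le _ _).trans (add_le_add (semigrProd_norm A hMA0 hMA u hu)
        (semigrProd_norm B hMB0 hMB u hu))
    have e1 : ∑ i, (-1 : ℝ) * u i = - ∑ i, u i := by simp
    rw [e1]
    set s := ∑ i, u i
    have hA : 0 ≤ MA ^ n + MB ^ n := by positivity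
    have h1 : (s + 1) * Real.exp (-s) ≤ 1 := by
      have := mul_le_mul_of_nonneg_right (Real.add_one_le_exp s) (Real.exp_pos (-s)).le
      rwa [← Real.exp_add, add_neg_cancel, Real.exp_zero] at this
    have hE := Real.exp_pos (-s)
    rcases le_total s 1 with hs | hs
    · have h2 : s ≤ 2 * (1 - Real.exp (-s)) := by nlinarith
      have h3 : C * s ≤ C * (2 * (1 - Real.exp (-s))) := by gcongr
      have h4 : 0 ≤ (MA ^ n + MB ^ n) * (1 - Real.exp (-s)) :=
        mul_nonneg hA (by linarith)
      linarith
    · have h2 : 1 ≤ 2 * (1 - Real.exp (-s)) := by nlinarith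
      have h3 : (MA ^ n + MB ^ n) * 1 ≤ (MA ^ n + MB ^ n) * (2 * (1 - Real.exp (-s))) := by gcongr
      have h4 : 0 ≤ C * (1 - Real.exp (-s)) :=
        mul_nonneg hC0 (by linarith)
      linarith
  refine ⟨∫ u, (semigrProd A u - semigrProd B u) ∂ρ.μ, fun x _ => ?_, ?_⟩
  · rw [ContinuousLinearMap.integral_apply hint]
    rfl
  · exact integral_compact _ hint (hpos.mono fun u hu => (hC u hu).2)
end
end

section
/- Let ψ ∈ 𝒯₁ have the integral representation ψ(s) = ∫_{(0,∞)} (e^{su} − 1) dμ(u) and suppose ψ′(−0) ≠ ∞. Then the function φ(s₁, s₂), defined as (ψ(s₁) − ψ(s₂))/(s₁ − s₂) − ψ′(−0) when s₁ ≠ s₂ and as ψ′(s₁) − ψ′(−0) when s₁ = s₂, belongs to 𝒯₂ and has the integral representation φ(s₁, s₂) = ∫_{ℝ₊²∖{0}} (e^{s₁u₁ + s₂u₂} − 1) dμ₁(u₁, u₂), where dμ₁(u₁, u₂) is the image of the measure (1/2)dμ(v)dw under the mapping u₁ = (v+w)/2, u₂ = (v−w)/2. -/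
open MeasureTheory

noncomputable section

/-- The mixed partial derivative `∂^{k₁}_{s₁} ∂^{k₂}_{s₂} f` of a function of two real
variables. -/
def mixedPartial (k₁ k₂ : ℕ) (f : ℝ × ℝ → ℝ) (p : ℝ × ℝ) : ℝ :=
  deriv^[k₁] (fun a => deriv^[k₂] (fun b => f (a, b)) p.2) p.1

/-- The open negative quadrant `(-∞,0)²`. -/
def negQuadrant : Set (ℝ × ℝ) := {p | p.1 < 0 ∧ p.2 < 0}

/-- `f` is a nonpositive Bernstein function of two variables (`f ∈ 𝒯₂`): it is
`C^∞` and nonpositive on `(-∞,0)²` and all of its partial derivatives of order `≥ 1`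
are nonnegative there (i.e. its first partial derivatives are absolutely monotone). -/
def MemT2 (f : ℝ × ℝ → ℝ) : Prop :=
  ContDiffOn ℝ (⊤ : ℕ∞) f negQuadrant ∧ (∀ p ∈ negQuadrant, f p ≤ 0) ∧
    ∀ k₁ k₂ : ℕ, 1 ≤ k₁ + k₂ → ∀ p ∈ negQuadrant, 0 ≤ mixedPartial k₁ k₂ f p


def Gint (ν : Measure (ℝ × ℝ)) (a b : ℕ) (p : ℝ × ℝ) : ℝ :=
  ∫ w, w.1 ^ a * w.2 ^ b * Real.exp (p.1 * w.1 + p.2 * w.2) ∂ν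

lemma negQuadrant_open : IsOpen negQuadrant :=
  (isOpen_lt continuous_fst continuous_const).inter (isOpen_lt continuous_snd continuous_const)

lemma pow_exp_bound (a : ℕ) {ε u s : ℝ} (hε : 0 < ε) (hu : 0 ≤ u) (hs : s ≤ -ε) :
    u ^ a * Real.exp (s * u) ≤ a.factorial / ε ^ a := by
  have h1 := Real.pow_div_factorial_le_exp (ε * u) (by positivity) a
  have h2 : Real.exp (s * u) ≤ Real.exp (-(ε * u)) := by
    apply Real.exp_le_exp.2; nlinarith
  rw [Real.exp_neg] at h2
  have hf : (0:ℝ) < a.factorial := by positivity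
  rw [div_le_iff₀ hf, mul_pow] at h1
  rw [le_div_iff₀ (by positivity)]
  calc u ^ a * Real.exp (s * u) * ε ^ a ≤ u ^ a * (Real.exp (ε * u))⁻¹ * ε ^ a := by gcongr
    _ = (ε ^ a * u ^ a) * (Real.exp (ε * u))⁻¹ := by ring
    _ ≤ (Real.exp (ε * u) * a.factorial) * (Real.exp (ε * u))⁻¹ := by gcongr
    _ = a.factorial := by field_simp

lemma integrand_bound (a b : ℕ) {ε : ℝ} {w p : ℝ × ℝ} (hε : 0 < ε) (hw : 0 ≤ w.1 ∧ 0 ≤ w.2)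
    (h1 : p.1 ≤ -ε) (h2 : p.2 ≤ -ε) :
    |w.1 ^ a * w.2 ^ b * Real.exp (p.1 * w.1 + p.2 * w.2)| ≤
      a.factorial / ε ^ a * (b.factorial / ε ^ b) := by
  obtain ⟨hw1, hw2⟩ := hw
  rw [abs_of_nonneg (by positivity), Real.exp_add]
  calc _ = (w.1 ^ a * Real.exp (p.1 * w.1)) * (w.2 ^ b * Real.exp (p.2 * w.2)) := by ring
    _ ≤ _ := mul_le_mul (pow_exp_bound a hε hw1 h1) (pow_exp_bound b hε hw2 h2)
      (by positivity) (by positivity)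

lemma integrand_meas (ν : Measure (ℝ × ℝ)) (a b : ℕ) (p : ℝ × ℝ) : AEStronglyMeasurable
    (fun w : ℝ × ℝ => w.1 ^ a * w.2 ^ b * Real.exp (p.1 * w.1 + p.2 * w.2)) ν := by
  apply Continuous.aestronglyMeasurable; fun_prop

lemma integrand_integrable (ν : Measure (ℝ × ℝ)) [IsFiniteMeasure ν]
    (hν : ∀ᵐ w ∂ν, 0 ≤ w.1 ∧ 0 ≤ w.2) (a b : ℕ) {p : ℝ × ℝ} (hp : p ∈ negQuadrant) :
    Integrable (fun w : ℝ × ℝ => w.1 ^ a * w.2 ^ b * Real.exp (p.1 * w.1 + p.2 * w.2)) ν := by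
  obtain ⟨h1, h2⟩ := hp
  have hε : 0 < min (-p.1) (-p.2) := by simp [h1, h2]
  refine Integrable.of_bound (integrand_meas ν a b p)
    (a.factorial / (min (-p.1) (-p.2)) ^ a * (b.factorial / (min (-p.1) (-p.2)) ^ b)) ?_
  · filter_upwards [hν] with w hw
    exact integrand_bound a b hε hw (by linarith [min_le_left (-p.1) (-p.2)])
      (by linarith [min_le_right (-p.1) (-p.2)])

lemma Gint_hasFDerivAt (ν : Measure (ℝ × ℝ)) [IsFiniteMeasure ν]
    (hν : ∀ᵐ w ∂ν, 0 ≤ w.1 ∧ 0 ≤ w.2) (a b : ℕ) {p : ℝ × ℝ} (hp : p ∈ negQuadrant) :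
    HasFDerivAt (Gint ν a b)
      (Gint ν (a + 1) b p • ContinuousLinearMap.fst ℝ ℝ ℝ +
        Gint ν a (b + 1) p • ContinuousLinearMap.snd ℝ ℝ ℝ) p := by
  have hi1 := integrand_integrable ν hν (a + 1) b hp
  have hi2 := integrand_integrable ν hν a (b + 1) hp
  have key := hasFDerivAt_integral_of_dominated_of_fderiv_le (𝕜 := ℝ) (μ := ν)
    (F := fun p w => w.1 ^ a * w.2 ^ b * Real.exp (p.1 * w.1 + p.2 * w.2))
    (F' := fun p w =>
      (w.1 ^ (a + 1) * w.2 ^ b * Real.exp (p.1 * w.1 + p.2 * w.2)) •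
        ContinuousLinearMap.fst ℝ ℝ ℝ +
      (w.1 ^ a * w.2 ^ (b + 1) * Real.exp (p.1 * w.1 + p.2 * w.2)) •
        ContinuousLinearMap.snd ℝ ℝ ℝ)
    (x₀ := p) (s := {q | q.1 < p.1 / 2 ∧ q.2 < p.2 / 2})
    (bound := fun _ => 
      (let ε := min (-p.1) (-p.2) / 2
      (a + 1).factorial / ε ^ (a + 1) * (b.factorial / ε ^ b) +
        a.factorial / ε ^ a * ((b + 1).factorial / ε ^ (b + 1))))
    ?_ ?_ (integrand_integrable ν hν a b hp) ?_ ?_ (integrable_const _) ?_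
  · have e : (∫ w, ((w.1 ^ (a + 1) * w.2 ^ b * Real.exp (p.1 * w.1 + p.2 * w.2)) •
        ContinuousLinearMap.fst ℝ ℝ ℝ +
      (w.1 ^ a * w.2 ^ (b + 1) * Real.exp (p.1 * w.1 + p.2 * w.2)) •
        ContinuousLinearMap.snd ℝ ℝ ℝ) ∂ν) = (Gint ν (a + 1) b p • ContinuousLinearMap.fst ℝ ℝ ℝ +
        Gint ν a (b + 1) p • ContinuousLinearMap.snd ℝ ℝ ℝ) := by
      rw [integral_add (hi1.smul_const _) (hi2.smul_const _), integral_smul_const,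
        integral_smul_const]
      rfl
    rw [e] at key
    exact key
  · refine IsOpen.mem_nhds ((isOpen_lt continuous_fst continuous_const).inter
      (isOpen_lt continuous_snd continuous_const)) ?_
    obtain ⟨h1, h2⟩ := hp
    exact ⟨by change p.1 < p.1 / 2; linarith, by change p.2 < p.2 / 2; linarith⟩
  · exact Filter.Eventually.of_forall fun q => integrand_meas ν a b q
  · exact (hi1.aestronglyMeasurable.smul_const _).add (hi2.aestronglyMeasurable.smul_const _)
  · filter_upwards [hν] with w hw q hq
    have hε : 0 < min (-p.1) (-p.2) / 2 := by simp [hp.1, hp.2]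
    have b1 : q.1 ≤ - (min (-p.1) (-p.2) / 2) := by linarith [min_le_left (-p.1) (-p.2), hq.1]
    have b2 : q.2 ≤ - (min (-p.1) (-p.2) / 2) := by linarith [min_le_right (-p.1) (-p.2), hq.2]
    refine (norm_add_le _ _).trans (add_le_add ?_ ?_)
    · rw [norm_smul]
      refine (mul_le_of_le_one_right (norm_nonneg _) (ContinuousLinearMap.norm_fst_le ..)).trans ?_
      exact integrand_bound (a+1) b hε hw b1 b2
    · rw [norm_smul]
      refine (mul_le_of_le_one_right (norm_nonneg _) (ContinuousLinearMap.norm_snd_le ..)).trans ?_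
      exact integrand_bound a (b+1) hε hw b1 b2
  · refine Filter.Eventually.of_forall fun w q _ => ?_
    have h1 : HasFDerivAt (fun q : ℝ × ℝ => q.1 * w.1 + q.2 * w.2)
        (w.1 • ContinuousLinearMap.fst ℝ ℝ ℝ + w.2 • ContinuousLinearMap.snd ℝ ℝ ℝ) q :=
      (hasFDerivAt_fst.mul_const w.1).add (hasFDerivAt_snd.mul_const w.2)
    refine (h1.exp.const_mul (w.1 ^ a * w.2 ^ b)).congr_fderiv ?_
    ext <;> simp <;> ring

lemma Gint_contDiffOn (ν : Measure (ℝ × ℝ)) [IsFiniteMeasure ν]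
    (hν : ∀ᵐ w ∂ν, 0 ≤ w.1 ∧ 0 ≤ w.2) (n : ℕ) : ∀ a b : ℕ, ContDiffOn ℝ n (Gint ν a b) negQuadrant := by
  induction n with
  | zero =>
    intro a b
    simp only [Nat.cast_zero]
    rw [contDiffOn_zero]
    exact fun p hp => (Gint_hasFDerivAt ν hν a b hp).continuousAt.continuousWithinAt
  | succ n ih =>
    intro a b
    push_cast
    rw [contDiffOn_succ_iff_fderiv_of_isOpen negQuadrant_open]
    refine ⟨fun p hp => (Gint_hasFDerivAt ν hν a b hp).differentiableAt.differentiableWithinAt,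
      by simp, ?_⟩
    refine ContDiffOn.congr (f := fun p => Gint ν (a + 1) b p • ContinuousLinearMap.fst ℝ ℝ ℝ +
        Gint ν a (b + 1) p • ContinuousLinearMap.snd ℝ ℝ ℝ) ?_
      (fun p hp => (Gint_hasFDerivAt ν hν a b hp).fderiv)
    exact ((ih _ _).smul contDiffOn_const).add ((ih _ _).smul contDiffOn_const)

lemma iter_deriv_eq (f : ℝ → ℝ) (g : ℕ → ℝ → ℝ) (h0 : ∀ x < 0, f x = g 0 x)
    (hg : ∀ k, ∀ x < 0, HasDerivAt (g k) (g (k + 1) x) x) (k : ℕ) :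
    ∀ x < 0, deriv^[k] f x = g k x := by
  induction k with
  | zero => simpa using h0
  | succ k ih =>
    intro x hx
    rw [Function.iterate_succ_apply']
    have : deriv^[k] f =ᶠ[nhds x] g k := by
      filter_upwards [Iio_mem_nhds hx] with y hy using ih y hy
    rw [this.deriv_eq, (hg k x hx).deriv]

/-- inner integral -/
lemma inner_int (p : ℝ × ℝ) (v : ℝ) : 
    ∫ w in (-v)..v, (Real.exp (p.1 * ((v + w) / 2) + p.2 * ((v - w) / 2)) - 1) =
      if p.1 = p.2 then 2 * (Real.exp (p.1 * v) * v - v)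
      else 2 * (((Real.exp (p.1 * v) - 1) - (Real.exp (p.2 * v) - 1)) / (p.1 - p.2) - v) := by
  split_ifs with h
  · have : ∀ w : ℝ, p.1 * ((v + w) / 2) + p.2 * ((v - w) / 2) = p.1 * v := by
      intro w; rw [← h]; ring
    simp only [this, intervalIntegral.integral_const]
    simp; ring
  · have h' : p.1 - p.2 ≠ 0 := sub_ne_zero.2 h
    have hder : ∀ w ∈ Set.uIcc (-v) v, HasDerivAt (fun w : ℝ => 2 / (p.1 - p.2) *
        Real.exp (p.1 * ((v + w) / 2) + p.2 * ((v - w) / 2)) - w)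
        (Real.exp (p.1 * ((v + w) / 2) + p.2 * ((v - w) / 2)) - 1) w := by
      intro w _
      have h1 : HasDerivAt (fun w : ℝ => p.1 * ((v + w) / 2) + p.2 * ((v - w) / 2))
          (p.1 * (1 / 2) + p.2 * (-1 / 2)) w :=
        ((((hasDerivAt_id w).const_add v).div_const 2).const_mul p.1).add
          ((((hasDerivAt_id w).const_sub v).div_const 2).const_mul p.2)
      refine ((h1.exp.const_mul (2 / (p.1 - p.2))).sub (hasDerivAt_id w)).congr_deriv ?_
      have e : p.1 * (1 / 2) + p.2 * (-1 / 2) = (p.1 - p.2) / 2 := by ring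
      rw [e]
      field_simp
    rw [intervalIntegral.integral_eq_sub_of_hasDerivAt hder
      (Continuous.intervalIntegrable (by fun_prop) _ _)]
    have e1 : p.1 * ((v + v) / 2) + p.2 * ((v - v) / 2) = p.1 * v := by ring
    have e2 : p.1 * ((v + -v) / 2) + p.2 * ((v - -v) / 2) = p.2 * v := by ring
    rw [e1, e2]
    field_simp
    ring

lemma wedge_meas : MeasurableSet {q : ℝ × ℝ | |q.2| ≤ q.1} :=
  measurableSet_le (by fun_prop) (by fun_prop)

lemma wedge_finite (μ : Measure ℝ) [SigmaFinite μ]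
    (hd : Integrable (fun v => v) μ) :
    (μ.prod volume) {q : ℝ × ℝ | |q.2| ≤ q.1} < ⊤ := by
  rw [Measure.prod_apply wedge_meas]
  have h : ∀ v : ℝ, volume (Prod.mk v ⁻¹' {q : ℝ × ℝ | |q.2| ≤ q.1}) = ENNReal.ofReal (2 * v) := by
    intro v
    have : Prod.mk v ⁻¹' {q : ℝ × ℝ | |q.2| ≤ q.1} = Set.Icc (-v) v := by
      ext w; simp [abs_le]
    rw [this, Real.volume_Icc]
    congr 1; ring
  simp only [h]
  exact (hd.const_mul 2).lintegral_lt_top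

lemma outer_int (μ : Measure ℝ) [SigmaFinite μ] (hsupp : μ {v | v ≤ 0} = 0)
    (hd : Integrable (fun v => v) μ) (p : ℝ × ℝ) (hp : p ∈ negQuadrant) :
    ∫ q in {q : ℝ × ℝ | |q.2| ≤ q.1},
      (Real.exp (p.1 * ((q.1 + q.2) / 2) + p.2 * ((q.1 - q.2) / 2)) - 1) ∂(μ.prod volume) =
    ∫ v, (if p.1 = p.2 then 2 * (Real.exp (p.1 * v) * v - v)
      else 2 * (((Real.exp (p.1 * v) - 1) - (Real.exp (p.2 * v) - 1)) / (p.1 - p.2) - v)) ∂μ := by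
  have hfin := wedge_finite μ hd
  have hI : IntegrableOn (fun q : ℝ × ℝ =>
      Real.exp (p.1 * ((q.1 + q.2) / 2) + p.2 * ((q.1 - q.2) / 2)) - 1)
      {q : ℝ × ℝ | |q.2| ≤ q.1} (μ.prod volume) := by
    refine Measure.integrableOn_of_bounded (M := 1) hfin.ne
      (Continuous.aestronglyMeasurable (by fun_prop)) ?_
    filter_upwards [ae_restrict_mem wedge_meas] with q hq
    obtain ⟨h1, h2⟩ := abs_le.1 hq
    obtain ⟨hp1, hp2⟩ := hp
    have : p.1 * ((q.1 + q.2) / 2) + p.2 * ((q.1 - q.2) / 2) ≤ 0 :=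
      add_nonpos (mul_nonpos_of_nonpos_of_nonneg hp1.le (by linarith))
        (mul_nonpos_of_nonpos_of_nonneg hp2.le (by linarith))
    have h3 := Real.exp_le_one_iff.2 this
    have h4 := Real.exp_pos (p.1 * ((q.1 + q.2) / 2) + p.2 * ((q.1 - q.2) / 2))
    rw [Real.norm_eq_abs, abs_le]
    constructor <;> linarith
  rw [← integral_indicator wedge_meas, integral_prod _ (hI.integrable_indicator wedge_meas)]
  have hpos : ∀ᵐ v ∂μ, 0 < v := by
    rw [ae_iff]; simpa using hsupp
  refine integral_congr_ae ?_
  filter_upwards [hpos] with v hv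
  rw [← inner_int p v, intervalIntegral.integral_of_le (by linarith),
    ← integral_Icc_eq_integral_Ioc, ← integral_indicator measurableSet_Icc]
  refine integral_congr_ae (Filter.Eventually.of_forall fun w => ?_)
  simp only [Set.indicator, Set.mem_setOf_eq, Set.mem_Icc, abs_le]

/-- **Lemma 2.** Let `ψ ∈ 𝒯₁` have the integral representation
`ψ(s) = ∫_{(0,∞)} (e^{su} - 1) dμ(u)` and let `ψ'(-0) = ∫ v dμ(v) ≠ ∞`.  Then the
divided difference `φ(s₁,s₂)` (equal to `(ψ(s₁)-ψ(s₂))/(s₁-s₂) - ψ'(-0)` for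
`s₁ ≠ s₂` and to `ψ'(s₁) - ψ'(-0)` for `s₁ = s₂`) belongs to `𝒯₂` and has the
integral representation `φ(s₁,s₂) = ∫_{ℝ₊²∖{0}} (e^{s₁u₁+s₂u₂} - 1) dμ₁(u₁,u₂)`,
where `μ₁` is the image of the measure `(1/2) dμ(v) dw` (on `{(v,w) : |w| ≤ v}`)
under the mapping `u₁ = (v+w)/2`, `u₂ = (v-w)/2`. -/
theorem divided_difference_bernstein
    (μ : Measure ℝ) [SigmaFinite μ] (hsupp : μ {v | v ≤ 0} = 0)
    (hint : ∀ s : ℝ, s < 0 → Integrable (fun v => Real.exp (s * v) - 1) μ)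
    (hd : Integrable (fun v => v) μ)
    (ψ ψ' : ℝ → ℝ)
    (hψ : ∀ s : ℝ, s < 0 → ψ s = ∫ v, (Real.exp (s * v) - 1) ∂μ)
    (hψ' : ∀ s : ℝ, s ≤ 0 → ψ' s = ∫ v, Real.exp (s * v) * v ∂μ)
    (φ : ℝ × ℝ → ℝ)
    (hφ : ∀ p : ℝ × ℝ, φ p =
      if p.1 = p.2 then ψ' p.1 - ∫ v, v ∂μ
      else (ψ p.1 - ψ p.2) / (p.1 - p.2) - ∫ v, v ∂μ)
    (μ₁ : Measure (ℝ × ℝ))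
    (hμ₁ : μ₁ = Measure.map (fun q : ℝ × ℝ => ((q.1 + q.2) / 2, (q.1 - q.2) / 2))
      (((1 : ENNReal) / 2) • ((μ.prod volume).restrict {q : ℝ × ℝ | |q.2| ≤ q.1}))) :
    MemT2 φ ∧
      ∀ p ∈ negQuadrant, φ p = ∫ w, (Real.exp (p.1 * w.1 + p.2 * w.2) - 1) ∂μ₁ := by
  have hfin : IsFiniteMeasure ((μ.prod volume).restrict {q : ℝ × ℝ | |q.2| ≤ q.1}) :=
    ⟨by simpa using wedge_finite μ hd⟩
  have hT : Measurable (fun q : ℝ × ℝ => ((q.1 + q.2) / 2, (q.1 - q.2) / 2)) := by fun_prop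
  have hfin1 : IsFiniteMeasure μ₁ := by
    rw [hμ₁]
    have : IsFiniteMeasure (((1 : ENNReal) / 2) •
        ((μ.prod volume).restrict {q : ℝ × ℝ | |q.2| ≤ q.1})) :=
      Measure.smul_finite _ (by simp)
    infer_instance
  have hν : ∀ᵐ w ∂μ₁, 0 ≤ w.1 ∧ 0 ≤ w.2 := by
    have hms : MeasurableSet {w : ℝ × ℝ | 0 ≤ w.1 ∧ 0 ≤ w.2} :=
      (measurableSet_le measurable_const measurable_fst).inter
        (measurableSet_le measurable_const measurable_snd)
    rw [hμ₁, ae_map_iff hT.aemeasurable hms]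
    refine Measure.ae_smul_measure ?_ _
    filter_upwards [ae_restrict_mem wedge_meas] with q hq
    obtain ⟨h1, h2⟩ := abs_le.1 hq
    constructor <;> linarith
  have hrep : ∀ p ∈ negQuadrant, φ p = ∫ w, (Real.exp (p.1 * w.1 + p.2 * w.2) - 1) ∂μ₁ := by
    intro p hp
    obtain ⟨hp1, hp2⟩ := id hp
    have hb : Integrable (fun v => Real.exp (p.1 * v) * v) μ := by
      refine hd.mono (Continuous.aestronglyMeasurable (by fun_prop)) ?_
      have hpos : ∀ᵐ v ∂μ, 0 < v := by
        rw [ae_iff]; simpa using hsupp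
      filter_upwards [hpos] with v hv
      rw [norm_mul]
      refine mul_le_of_le_one_left (norm_nonneg _) ?_
      rw [Real.norm_eq_abs, Real.abs_exp, Real.exp_le_one_iff]
      exact mul_nonpos_of_nonpos_of_nonneg hp1.le hv.le
    rw [hμ₁, integral_map hT.aemeasurable (Continuous.aestronglyMeasurable (by fun_prop)),
      integral_smul_measure]
    simp only
    rw [outer_int μ hsupp hd p hp, hφ p]
    have hhalf : ((1 : ENNReal) / 2).toReal = 1 / 2 := by simp
    rw [hhalf]
    split_ifs with h
    · rw [integral_const_mul, integral_sub hb hd, hψ' _ hp1.le, smul_eq_mul]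
      ring
    · have hdiff : Integrable (fun v => (Real.exp (p.1 * v) - 1 - (Real.exp (p.2 * v) - 1)) /
          (p.1 - p.2)) μ := ((hint _ hp1).sub (hint _ hp2)).div_const _
      rw [integral_const_mul, integral_sub hdiff hd,
        integral_div, integral_sub (hint _ hp1) (hint _ hp2), hψ _ hp1, hψ _ hp2, smul_eq_mul]
      ring
  refine ⟨?_, hrep⟩
  set m : ℝ := μ₁.real Set.univ with hm
  have hG : ∀ p ∈ negQuadrant, φ p = Gint μ₁ 0 0 p - m := by
    intro p hp
    have hi := integrand_integrable μ₁ hν 0 0 hp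
    simp only [pow_zero, one_mul] at hi
    rw [hrep p hp, integral_sub hi (integrable_const _)]
    simp [Gint, hm]
  refine ⟨?_, ?_, ?_⟩
  · refine ContDiffOn.congr ?_ hG
    exact ContDiffOn.sub (contDiffOn_infty.2 fun n => Gint_contDiffOn μ₁ hν n 0 0)
      contDiffOn_const
  · intro p hp
    rw [hrep p hp]
    refine integral_nonpos_of_ae ?_
    filter_upwards [hν] with w hw
    have : p.1 * w.1 + p.2 * w.2 ≤ 0 :=
      add_nonpos (mul_nonpos_of_nonpos_of_nonneg hp.1.le hw.1)
        (mul_nonpos_of_nonpos_of_nonneg hp.2.le hw.2)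
    simpa using this
  · intro k₁ k₂ hk p hp
    have hd1 : ∀ (a b : ℕ) (x y : ℝ), x < 0 → y < 0 →
        HasDerivAt (fun x => Gint μ₁ a b (x, y)) (Gint μ₁ (a + 1) b (x, y)) x := by
      intro a b x y hx hy
      have := (Gint_hasFDerivAt μ₁ hν a b (p := (x, y)) ⟨hx, hy⟩).comp_hasDerivAt x
        ((hasDerivAt_id x).prodMk (hasDerivAt_const x y))
      exact this.congr_deriv (by simp)
    have hd2 : ∀ (a b : ℕ) (x y : ℝ), x < 0 → y < 0 →
        HasDerivAt (fun y => Gint μ₁ a b (x, y)) (Gint μ₁ a (b + 1) (x, y)) y := by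
      intro a b x y hx hy
      have := (Gint_hasFDerivAt μ₁ hν a b (p := (x, y)) ⟨hx, hy⟩).comp_hasDerivAt y
        ((hasDerivAt_const y x).prodMk (hasDerivAt_id y))
      exact this.congr_deriv (by simp)
    have hin : ∀ x < 0, deriv^[k₂] (fun b => φ (x, b)) p.2 =
        Gint μ₁ 0 k₂ (x, p.2) - (if k₂ = 0 then m else 0) := by
      intro x hx
      refine iter_deriv_eq (fun b => φ (x, b))
        (fun k y => Gint μ₁ 0 k (x, y) - (if k = 0 then m else 0)) ?_ ?_ k₂ p.2 hp.2
      · intro y hy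
        simpa using hG (x, y) ⟨hx, hy⟩
      · intro k y hy
        simpa using (hd2 0 k x y hx hy).sub_const (if k = 0 then m else 0)
    have hout : mixedPartial k₁ k₂ φ p =
        Gint μ₁ k₁ k₂ (p.1, p.2) - (if k₁ = 0 then (if k₂ = 0 then m else 0) else 0) := by
      refine iter_deriv_eq _
        (fun k x => Gint μ₁ k k₂ (x, p.2) - (if k = 0 then (if k₂ = 0 then m else 0) else 0))
        ?_ ?_ k₁ p.1 hp.1
      · intro x hx
        simpa using hin x hx
      · intro k x hx
        simpa using (hd1 k k₂ x p.2 hx hp.2).sub_const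
          (if k = 0 then (if k₂ = 0 then m else 0) else 0)
    have hz : (if k₁ = 0 then (if k₂ = 0 then m else 0) else 0) = 0 := by
      split_ifs <;> first | rfl | omega
    rw [hout, hz, sub_zero]
    refine integral_nonneg_of_ae ?_
    filter_upwards [hν] with w hw
    obtain ⟨h1, h2⟩ := hw
    simp only [Pi.zero_apply]
    positivity
end
end

section
/- Let X be a complex Banach space with the approximation property. Let A and B be generators of C₀-semigroups T_A and T_B on X which are holomorphic in the half plane {Re(z) > 0} and satisfy ‖T_A(z)‖ ≤ M and ‖T_B(z)‖ ≤ M for Re(z) > 0. If A − B is nuclear (A − B ∈ 𝔖₁), then there exists a unique tempered distribution ξ supported in ℝ₊ such that for every ψ ∈ 𝒯₁ with ψ′(−0) ≠ ∞ one has tr(ψ(A) − ψ(B)) = ∫_{(0,∞)} ⟨ξ(t), e^{−ut}⟩ u dμ(u), where μ is the representing measure of ψ and ⟨ξ(t), φ(t)⟩ denotes the action of the distribution ξ on a test function φ. -/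
open MeasureTheory Complex ContinuousLinearMap

noncomputable section

variable {X : Type*} [NormedAddCommGroup X] [NormedSpace ℂ X] [CompleteSpace X]

/-- A Banach space `X` has the approximation property if the identity can be
approximated, uniformly on compact sets, by finite rank (bounded) operators. -/
def ApproxProperty (X : Type*) [NormedAddCommGroup X] [NormedSpace ℂ X] : Prop :=
  ∀ K : Set X, IsCompact K → ∀ ε > (0 : ℝ), ∃ F : X →L[ℂ] X,
    FiniteDimensional ℂ (LinearMap.range (F : X →ₗ[ℂ] X)) ∧ ∀ x ∈ K, ‖F x - x‖ ≤ ε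

/-- A bounded operator on `X` is nuclear (belongs to `𝔖₁`) if it admits a
representation `S x = ∑ₖ fₖ(x) yₖ` with `∑ₖ ‖fₖ‖ ‖yₖ‖ < ∞`. -/
def IsNuclear (S : X →L[ℂ] X) : Prop :=
  ∃ (f : ℕ → (X →L[ℂ] ℂ)) (y : ℕ → X),
    Summable (fun k => ‖f k‖ * ‖y k‖) ∧ ∀ x : X, HasSum (fun k => f k x • y k) (S x)

/-- The nuclear norm `‖S‖_{𝔖₁}`: the infimum of `∑ₖ ‖fₖ‖ ‖yₖ‖` over all nuclear
representations of `S`. -/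
def nuclearNorm (S : X →L[ℂ] X) : ℝ :=
  sInf {c : ℝ | ∃ (f : ℕ → (X →L[ℂ] ℂ)) (y : ℕ → X),
    (∀ x : X, HasSum (fun k => f k x • y k) (S x)) ∧ HasSum (fun k => ‖f k‖ * ‖y k‖) c}

/-- The generator of a `C₀`-semigroup on `X` which is holomorphic in the half plane
`{Re z > 0}`, bundled with the semigroup, its domain and its action (extended by `0`
outside of the domain). -/
structure HoloGen (X : Type*) [NormedAddCommGroup X] [NormedSpace ℂ X] where
  T : ℂ → X →L[ℂ] X
  T_zero : T 0 = 1
  T_add_pos : ∀ ⦃z w : ℂ⦄, 0 < z.re → 0 < w.re → T (z + w) = (T z).comp (T w)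
  T_add_real : ∀ ⦃s t : ℝ⦄, 0 ≤ s → 0 ≤ t →
    T ((s + t : ℝ) : ℂ) = (T (s : ℂ)).comp (T (t : ℂ))
  holo : DifferentiableOn ℂ T {z : ℂ | 0 < z.re}
  strong_cont : ∀ x : X, ContinuousOn (fun t : ℝ => T (t : ℂ) x) (Set.Ici 0)
  dom : Submodule ℂ X
  gen : X → X
  mem_dom_iff : ∀ x : X, x ∈ dom ↔ ∃ y : X,
    Filter.Tendsto (fun t : ℝ => (t : ℂ)⁻¹ • (T (t : ℂ) x - x))
      (nhdsWithin 0 (Set.Ioi 0)) (nhds y)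
  gen_spec : ∀ x ∈ dom,
    Filter.Tendsto (fun t : ℝ => (t : ℂ)⁻¹ • (T (t : ℂ) x - x))
      (nhdsWithin 0 (Set.Ioi 0)) (nhds (gen x))
  gen_zero : ∀ x, x ∉ dom → gen x = 0

/-- The test space `𝒮_{ℝ₊}` of smooth functions `φ` on the half line with all
seminorms `‖φ‖_{j,m} = sup_{t ≥ 0} t^m |φ^{(j)}(t)|` finite (modeled by smooth
functions on `ℝ`; only the restriction to `ℝ₊` matters). -/
def TestSet : Set (ℝ → ℂ) :=
  {φ | ContDiff ℝ (⊤ : ℕ∞) φ ∧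
    ∀ j m : ℕ, ∃ C : ℝ, ∀ t : ℝ, 0 ≤ t → t ^ m * ‖iteratedDeriv j φ t‖ ≤ C}

/-- The seminorm `‖φ‖_{j,m} = sup_{t ≥ 0} t^m |φ^{(j)}(t)|` on `𝒮_{ℝ₊}`. -/
def sNorm (j m : ℕ) (φ : ℝ → ℂ) : ℝ :=
  sInf {C : ℝ | ∀ t : ℝ, 0 ≤ t → t ^ m * ‖iteratedDeriv j φ t‖ ≤ C}

/-- A tempered distribution supported in `ℝ₊`, identified (as in the paper) with a
linear functional on the test space `𝒮_{ℝ₊}` which is continuous with respect to the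
seminorms `‖·‖_{j,m}`. -/
def IsTemperedDistRplus (ξ : (ℝ → ℂ) → ℂ) : Prop :=
  (∀ φ₁ ∈ TestSet, ∀ φ₂ ∈ TestSet, ξ (φ₁ + φ₂) = ξ φ₁ + ξ φ₂) ∧
  (∀ (c : ℂ), ∀ φ ∈ TestSet, ξ (c • φ) = c * ξ φ) ∧
  ∃ (k : ℕ) (C : ℝ), ∀ φ ∈ TestSet,
    ‖ξ φ‖ ≤ C * ∑ j ∈ Finset.range (k + 1), ∑ m ∈ Finset.range (k + 1), sNorm j m φ

/-- The Livschits–Kreĭn trace formula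
`tr(ψ(A) - ψ(B)) = ∫_{(0,∞)} ⟨ξ(t), e^{-ut}⟩ u dμ(u)` holds for every `ψ ∈ 𝒯₁`
with representing measure `μ` and `ψ'(-0) ≠ ∞`; here `D = ψ(A) - ψ(B)` is the
bounded operator extending `x ↦ ∫ (T_A(u) - T_B(u))x dμ(u)` from `D(A)`. -/
def TraceFormulaHolds (tr : (X →L[ℂ] X) → ℂ) (A B : HoloGen X)
    (ξ : (ℝ → ℂ) → ℂ) : Prop :=
  ∀ μ : Measure ℝ, μ {v : ℝ | v ≤ 0} = 0 →
    (∀ s : ℝ, s < 0 → Integrable (fun v => Real.exp (s * v) - 1) μ) →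
    Integrable (fun v => v) μ →
    ∀ D : X →L[ℂ] X,
      (∀ x ∈ A.dom, D x = ∫ u, (A.T (u : ℂ) x - B.T (u : ℂ) x) ∂μ) →
      tr D = ∫ u, ξ (fun t => Complex.exp (-((u : ℂ) * (t : ℂ)))) * (u : ℂ) ∂μ


section LaplaceInversion
open Filter Topology FourierTransform

lemma aux_contour_shift (E : ℂ → ℂ) (hE : DifferentiableOn ℂ E {z : ℂ | 0 < z.re}) (a b C : ℝ)
    (ha : 0 < a) (hab : a ≤ b)
    (hC : ∀ z : ℂ, a ≤ z.re → z.re ≤ b → ‖E z‖ ≤ C * (1 + z.im ^ 2)⁻¹) :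
    ∫ y : ℝ, E (a + y * I) = ∫ y : ℝ, E (b + y * I) := by
  have hIntegr : ∀ c : ℝ, a ≤ c → c ≤ b → Integrable (fun y : ℝ => E (c + y * I)) := by
    intro c hac hcb
    have hcont : Continuous (fun y : ℝ => E (c + y * I)) := by
      rw [← continuousOn_univ]
      apply hE.continuousOn.comp (by fun_prop)
      intro y _
      simp only [Set.mem_ofPred_eq, add_re, ofReal_re, mul_re, I_re, mul_zero, ofReal_im, I_im,
        mul_one, sub_self, add_zero]
      linarith
    refine Integrable.mono' (integrable_inv_one_add_sq.const_mul C) hcont.aestronglyMeasurable ?_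
    refine Eventually.of_forall fun y => ?_
    simpa using hC (c + y * I) (by simpa using hac) (by simpa using hcb)
  have h1 := intervalIntegral_tendsto_integral (hIntegr a le_rfl hab) tendsto_neg_atTop_atBot tendsto_id
  have h2 := intervalIntegral_tendsto_integral (hIntegr b hab le_rfl) tendsto_neg_atTop_atBot tendsto_id
  have hz : Tendsto (fun R : ℝ => C * (1 + R ^ 2)⁻¹ * |b - a|) atTop (𝓝 0) := by
    have : Tendsto (fun R : ℝ => (1 + R ^ 2)⁻¹) atTop (𝓝 0) :=
      tendsto_inv_atTop_zero.comp
        (tendsto_atTop_add_const_left _ 1 (tendsto_pow_atTop two_ne_zero))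
    simpa using (this.const_mul C).mul_const |b - a|
  have hbd : ∀ s : ℝ, ‖∫ x in a..b, E (x + s * I)‖ ≤ C * (1 + s ^ 2)⁻¹ * |b - a| := by
    intro s
    apply intervalIntegral.norm_integral_le_of_norm_le_const
    intro x hx
    rw [Set.uIoc_of_le hab] at hx
    simpa using hC (x + s * I) (by simpa using hx.1.le) (by simpa using hx.2)
  have h3 : Tendsto (fun R : ℝ => ∫ x in a..b, E (x + (R : ℝ) * I)) atTop (𝓝 0) :=
    squeeze_zero_norm (fun R => hbd R) hz
  have h4 : Tendsto (fun R : ℝ => ∫ x in a..b, E (x + ((-R : ℝ) : ℂ) * I)) atTop (𝓝 0) :=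
    squeeze_zero_norm (fun R => by simpa using hbd (-R)) hz
  have key : ∀ R : ℝ, (((∫ x in a..b, E (x + ((-R : ℝ) : ℂ) * I)) -
      ∫ x in a..b, E (x + (R : ℝ) * I)) +
      I • ∫ y in (-R)..R, E (b + y * I)) - I • ∫ y in (-R)..R, E (a + y * I) = 0 := by
    intro R
    have := Complex.integral_boundary_rect_eq_zero_of_differentiableOn E (a + (-R : ℝ) * I)
      (b + R * I) ?_
    · simpa using this
    · apply hE.mono
      intro z hz
      have := (Complex.mem_reProdIm.1 hz).1
      simp only [add_re, ofReal_re, mul_re, I_re, mul_zero, ofReal_im, I_im,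
        mul_one, sub_self, add_zero] at this
      rw [Set.uIcc_of_le hab] at this
      exact lt_of_lt_of_le ha this.1
  have h5 := (((h4.sub h3).add (h2.const_smul I)).sub (h1.const_smul I))
  have h6 : Tendsto (fun _ : ℝ => (0 : ℂ)) atTop (𝓝 ((0 - 0 + I • ∫ y : ℝ, E (b + y * I)) -
      I • ∫ y : ℝ, E (a + y * I))) := by
    refine h5.congr fun R => ?_
    simpa using key R
  have h7 := tendsto_nhds_unique h6 tendsto_const_nhds
  have h8 : I * ((∫ y : ℝ, E (b + y * I)) - ∫ y : ℝ, E (a + y * I)) = 0 := by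
    rw [← h7]; simp [mul_sub]
  rcases mul_eq_zero.1 h8 with h | h
  · exact absurd h I_ne_zero
  · exact (sub_eq_zero.1 h).symm

lemma aux_laplace_inv (F : ℂ → ℂ) (hF : DifferentiableOn ℂ F {z : ℂ | 0 < z.re}) (K : ℝ)
    (hK : ∀ z : ℂ, 0 < z.re → ‖F z‖ ≤ K * (1 + z.im ^ 2)⁻¹) :
    ∃ H : ℝ → ℂ, Continuous H ∧ (∀ w < 0, H w = 0) ∧ (∀ w, ‖H w‖ ≤ K * Real.pi) ∧
      ∀ c : ℝ, 0 < c → ∫ w : ℝ, cexp (-(2 * Real.pi * c * w : ℝ)) * H w = F c := by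
  have hcont : ∀ c : ℝ, 0 < c → Continuous (fun y : ℝ => F (c + y * I)) := by
    intro c hc
    rw [← continuousOn_univ]
    apply hF.continuousOn.comp (by fun_prop)
    intro y _
    simpa using hc
  have hIntegr : ∀ c : ℝ, 0 < c → Integrable (fun y : ℝ => F (c + y * I)) := by
    intro c hc
    refine Integrable.mono' (integrable_inv_one_add_sq.const_mul K)
      (hcont c hc).aestronglyMeasurable ?_
    refine Eventually.of_forall fun y => ?_
    simpa using hK (c + y * I) (by simpa using hc)
  set G : ℝ → ℝ → ℂ := fun c => 𝓕⁻ (fun y : ℝ => F (c + y * I)) with hG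
  have hK0 : 0 ≤ K := by
    have := (norm_nonneg _).trans (hK 1 (by simp))
    simpa using this
  have hGbd : ∀ c : ℝ, 0 < c → ∀ w, ‖G c w‖ ≤ K * Real.pi := by
    intro c hc w
    rw [hG]
    simp only [Real.fourierInv_eq']
    have hpi : K * Real.pi = ∫ y : ℝ, K * (1 + y ^ 2)⁻¹ := by
      rw [integral_const_mul, integral_univ_inv_one_add_sq]
    rw [hpi]
    refine norm_integral_le_of_norm_le (integrable_inv_one_add_sq.const_mul K) ?_
    refine Eventually.of_forall fun y => ?_
    rw [norm_smul, Complex.norm_exp_ofReal_mul_I, one_mul]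
    simpa using hK (c + y * I) (by simpa using hc)
  have hGcont : ∀ c : ℝ, 0 < c → Continuous (G c) := by
    intro c hc
    have h1 : Continuous (𝓕 (fun y : ℝ => F (c + y * I))) :=
      VectorFourier.fourierIntegral_continuous Real.continuous_fourierChar
        (continuous_inner (𝕜 := ℝ) (E := ℝ)) (hIntegr c hc)
    have h2 : G c = fun w => 𝓕 (fun y : ℝ => F (c + y * I)) (-w) := by
      ext w
      rw [hG]
      simp only [Real.fourierInv_eq_fourier_neg]
    rw [h2]
    exact h1.comp continuous_neg
  have hGe : ∀ c : ℝ, 0 < c → ∀ w : ℝ, cexp ((2 * Real.pi * c * w : ℝ)) * G c w =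
      ∫ y : ℝ, (fun z => cexp (2 * Real.pi * w * z) * F z) (c + y * I) := by
    intro c hc w
    rw [hG]
    simp only [Real.fourierInv_eq']
    rw [← integral_const_mul]
    congr 1
    ext y
    rw [smul_eq_mul, ← mul_assoc, ← Complex.exp_add]
    congr 2
    simp
    ring
  have hshift0 : ∀ a b : ℝ, 0 < a → a ≤ b → ∀ w : ℝ, cexp ((2 * Real.pi * a * w : ℝ)) * G a w =
      cexp ((2 * Real.pi * b * w : ℝ)) * G b w := by
    intro a b ha hab w
    rw [hGe a ha, hGe b (ha.trans_le hab)]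
    refine aux_contour_shift (fun z => cexp (2 * Real.pi * w * z) * F z) ?_ a b (Real.exp (2 * Real.pi * |w| * b) * K) ha hab ?_
    · apply DifferentiableOn.mul _ hF
      fun_prop
    · intro z hza hzb
      rw [norm_mul, mul_assoc (Real.exp _)]
      apply mul_le_mul _ (hK z (ha.trans_le hza)) (norm_nonneg _) (Real.exp_pos _).le
      rw [Complex.norm_exp]
      apply Real.exp_le_exp.2
      have : (2 * (Real.pi : ℂ) * w * z).re = 2 * Real.pi * w * z.re := by
        have : (2 * (Real.pi : ℂ) * w * z) = ((2 * Real.pi * w : ℝ) : ℂ) * z := by push_cast; ring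
        rw [this, Complex.re_ofReal_mul]
      rw [this]
      have hz0 : 0 ≤ z.re := (ha.trans_le hza).le
      have := Real.pi_pos
      calc 2 * Real.pi * w * z.re ≤ 2 * Real.pi * |w| * z.re := by
            gcongr; exact le_abs_self w
        _ ≤ _ := by gcongr
  have hshift : ∀ a b : ℝ, 0 < a → 0 < b → ∀ w : ℝ, cexp ((2 * Real.pi * a * w : ℝ)) * G a w =
      cexp ((2 * Real.pi * b * w : ℝ)) * G b w := by
    intro a b ha hb w
    rcases le_total a b with h | h
    · exact hshift0 a b ha h w
    · exact (hshift0 b a hb h w).symm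
  set H : ℝ → ℂ := fun w => cexp ((2 * Real.pi * 1 * w : ℝ)) * G 1 w with hH
  have hHc : ∀ c : ℝ, 0 < c → ∀ w, H w = cexp ((2 * Real.pi * c * w : ℝ)) * G c w :=
    fun c hc w => hshift 1 c one_pos hc w
  have hHcont : Continuous H := by
    have := hGcont 1 one_pos
    rw [hH]; fun_prop
  have hHn : ∀ c : ℝ, 0 < c → ∀ w, ‖H w‖ ≤ Real.exp (2 * Real.pi * c * w) * (K * Real.pi) := by
    intro c hc w
    rw [hHc c hc, norm_mul, ← Complex.ofReal_exp, Complex.norm_real, Real.norm_eq_abs, Real.abs_exp]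
    gcongr
    exact hGbd c hc w
  have hHbd : ∀ w, ‖H w‖ ≤ K * Real.pi := by
    intro w
    have ht : Tendsto (fun c : ℝ => Real.exp (2 * Real.pi * c * w) * (K * Real.pi)) (𝓝[>] 0)
        (𝓝 (Real.exp (2 * Real.pi * 0 * w) * (K * Real.pi))) := by
      apply Tendsto.mono_left _ nhdsWithin_le_nhds
      apply Continuous.tendsto
      fun_prop
    have := ge_of_tendsto ht (by
      filter_upwards [self_mem_nhdsWithin] with c hc
      exact hHn c hc w)
    simpa using this
  have hH0 : ∀ w < 0, H w = 0 := by
    intro w hw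
    have ht : Tendsto (fun c : ℝ => Real.exp (2 * Real.pi * c * w) * (K * Real.pi)) atTop
        (𝓝 (0 * (K * Real.pi))) := by
      apply Tendsto.mul_const
      apply Real.tendsto_exp_atBot.comp
      have h0 : 2 * Real.pi * w < 0 := by nlinarith [Real.pi_pos]
      have := tendsto_id.const_mul_atTop_of_neg h0 (l := atTop)
      refine this.congr fun c => ?_
      simp; ring
    have := ge_of_tendsto ht (by
      filter_upwards [eventually_gt_atTop 0] with c hc
      exact hHn c hc w)
    rw [zero_mul] at this
    exact norm_le_zero_iff.1 this
  refine ⟨H, hHcont, hH0, hHbd, ?_⟩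
  intro c hc
  have hGH : ∀ w, G c w = cexp (-(2 * Real.pi * c * w : ℝ)) * H w := by
    intro w
    rw [hHc c hc, ← mul_assoc, ← Complex.exp_add]
    simp
  have hGint : Integrable (G c) := by
    have hi : IntegrableOn (fun w : ℝ => Real.exp (-(2 * Real.pi * c) * w) * (K * Real.pi))
        (Set.Ici 0) := by
      rw [integrableOn_Ici_iff_integrableOn_Ioi]
      exact (exp_neg_integrableOn_Ioi 0 (by positivity)).mul_const _
    have h1 : IntegrableOn (G c) (Set.Ici 0) := by
      refine Integrable.mono' hi (hGcont c hc).aestronglyMeasurable ?_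
      refine Eventually.of_forall fun w => ?_
      rw [hGH, norm_mul, ← Complex.ofReal_neg, ← Complex.ofReal_exp, Complex.norm_real,
        Real.norm_eq_abs, Real.abs_exp]
      rw [neg_mul]
      gcongr
      exact hHbd w
    rw [← integrableOn_univ, ← Set.Iio_union_Ici (a := (0 : ℝ))]
    refine IntegrableOn.union ?_ h1
    refine (integrableOn_zero).congr_fun ?_ measurableSet_Iio
    intro w hw
    simp only
    rw [hGH, hH0 w hw, mul_zero]
  have hFint : Integrable (𝓕 (fun y : ℝ => F (c + y * I))) := by
    have h2 : 𝓕 (fun y : ℝ => F (c + y * I)) = fun w => G c (-w) := by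
      ext w
      rw [hG]
      simp only [Real.fourierInv_eq_fourier_neg, neg_neg]
    rw [h2]
    exact hGint.comp_neg
  have := (hIntegr c hc).fourier_fourierInv_eq hFint (v := 0) (hcont c hc).continuousAt
  simp only [ofReal_zero, zero_mul, add_zero] at this
  rw [← this, Real.fourier_eq']
  simp only [inner_zero_right, mul_zero, ofReal_zero, zero_mul, Complex.exp_zero, one_smul]
  congr 1
  ext w
  exact (hGH w).symm

end LaplaceInversion

section TestSpace
open Filter Topology

lemma aux_iteratedDeriv_exp (u : ℂ) (j : ℕ) :
    iteratedDeriv j (fun t : ℝ => cexp (-(u * (t : ℂ)))) =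
      fun t : ℝ => (-u) ^ j * cexp (-(u * (t : ℂ))) := by
  induction j with
  | zero => simp
  | succ j ih =>
    rw [iteratedDeriv_succ, ih]
    ext t
    have h1 : HasDerivAt (fun t : ℝ => -(u * (t : ℂ))) (-(u * 1)) t :=
      ((HasDerivAt.ofReal_comp (hasDerivAt_id t)).const_mul u).neg
    have h2 := (h1.cexp.const_mul ((-u) ^ j)).deriv
    rw [h2]
    ring

lemma aux_pow_mul_exp_le (m : ℕ) {u t : ℝ} (hu : 0 < u) (ht : 0 ≤ t) :
    t ^ m * Real.exp (-(u * t)) ≤ m.factorial / u ^ m := by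
  have h1 : (u * t) ^ m / m.factorial ≤ Real.exp (u * t) :=
    Real.pow_div_factorial_le_exp (u * t) (by positivity) m
  rw [Real.exp_neg, ← div_eq_mul_inv, div_le_div_iff₀ (Real.exp_pos _) (by positivity)]
  rw [div_le_iff₀ (by positivity), mul_pow] at h1
  linarith

lemma aux_norm_exp (u t : ℝ) : ‖cexp (-((u : ℂ) * (t : ℂ)))‖ = Real.exp (-(u * t)) := by
  rw [Complex.norm_exp]; simp

lemma aux_exp_mem {u : ℝ} (hu : 0 < u) :
    (fun t : ℝ => cexp (-((u : ℂ) * (t : ℂ)))) ∈ TestSet := by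
  refine ⟨?_, ?_⟩
  · exact ((contDiff_const.mul Complex.ofRealCLM.contDiff).neg).cexp
  · intro j m
    refine ⟨u ^ j * (m.factorial / u ^ m), fun t ht => ?_⟩
    rw [aux_iteratedDeriv_exp]
    simp only
    rw [norm_mul, aux_norm_exp, norm_pow, norm_neg, Complex.norm_real, Real.norm_eq_abs,
      abs_of_pos hu, mul_left_comm]
    exact mul_le_mul_of_nonneg_left (aux_pow_mul_exp_le m hu ht) (by positivity)

lemma aux_sNorm_le {j m : ℕ} {φ : ℝ → ℂ} {C : ℝ}
    (h : ∀ t : ℝ, 0 ≤ t → t ^ m * ‖iteratedDeriv j φ t‖ ≤ C) : sNorm j m φ ≤ C := by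
  unfold sNorm
  refine csInf_le ⟨0, fun c hc => ?_⟩ (by exact h)
  exact le_trans (by positivity) (hc 0 le_rfl)

lemma aux_le_sNorm {φ : ℝ → ℂ} (hφ : φ ∈ TestSet) (j m : ℕ) {t : ℝ} (ht : 0 ≤ t) :
    t ^ m * ‖iteratedDeriv j φ t‖ ≤ sNorm j m φ := by
  apply le_csInf (hφ.2 j m)
  intro c hc
  exact hc t ht

lemma aux_sNorm_nonneg {φ : ℝ → ℂ} (hφ : φ ∈ TestSet) (j m : ℕ) : 0 ≤ sNorm j m φ :=
  le_trans (by positivity) (aux_le_sNorm hφ j m le_rfl)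

lemma aux_cda {φ : ℝ → ℂ} (hφ : φ ∈ TestSet) (j : ℕ) (t : ℝ) : ContDiffAt ℝ j φ t :=
  (hφ.1.of_le (by exact_mod_cast le_top)).contDiffAt

lemma aux_iD_add {φ₁ φ₂ : ℝ → ℂ} (h₁ : φ₁ ∈ TestSet) (h₂ : φ₂ ∈ TestSet) (j : ℕ) (t : ℝ) :
    iteratedDeriv j (φ₁ + φ₂) t = iteratedDeriv j φ₁ t + iteratedDeriv j φ₂ t :=
  iteratedDeriv_add (aux_cda h₁ j t) (aux_cda h₂ j t)

lemma aux_iD_smul {φ : ℝ → ℂ} (h : φ ∈ TestSet) (c : ℂ) (j : ℕ) (t : ℝ) :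
    iteratedDeriv j (c • φ) t = c * iteratedDeriv j φ t := by
  rw [iteratedDeriv_const_smul (aux_cda h j t), smul_eq_mul]

lemma aux_add_mem {φ₁ φ₂ : ℝ → ℂ} (h₁ : φ₁ ∈ TestSet) (h₂ : φ₂ ∈ TestSet) :
    φ₁ + φ₂ ∈ TestSet := by
  refine ⟨h₁.1.add h₂.1, fun j m => ?_⟩
  obtain ⟨C₁, hC₁⟩ := h₁.2 j m
  obtain ⟨C₂, hC₂⟩ := h₂.2 j m
  refine ⟨C₁ + C₂, fun t ht => ?_⟩
  rw [aux_iD_add h₁ h₂]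
  calc t ^ m * ‖iteratedDeriv j φ₁ t + iteratedDeriv j φ₂ t‖
      ≤ t ^ m * (‖iteratedDeriv j φ₁ t‖ + ‖iteratedDeriv j φ₂ t‖) := by
        gcongr; exact norm_add_le _ _
    _ ≤ _ := by rw [mul_add]; exact add_le_add (hC₁ t ht) (hC₂ t ht)

lemma aux_smul_mem {φ : ℝ → ℂ} (h : φ ∈ TestSet) (c : ℂ) : c • φ ∈ TestSet := by
  refine ⟨contDiff_const.smul h.1, fun j m => ?_⟩
  obtain ⟨C₁, hC₁⟩ := h.2 j m
  refine ⟨‖c‖ * C₁, fun t ht => ?_⟩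
  rw [aux_iD_smul h, norm_mul, mul_left_comm]
  exact mul_le_mul_of_nonneg_left (hC₁ t ht) (norm_nonneg _)

lemma aux_cont_iD {φ : ℝ → ℂ} (h : φ ∈ TestSet) (j : ℕ) : Continuous (iteratedDeriv j φ) :=
  h.1.continuous_iteratedDeriv j (by exact_mod_cast le_top)

/-- The operator `φ ↦ (1 - d/dt)² φ`. -/
def auxL (φ : ℝ → ℂ) (t : ℝ) : ℂ :=
  iteratedDeriv 0 φ t - 2 * iteratedDeriv 1 φ t + iteratedDeriv 2 φ t

lemma aux_exists_xi (f : ℂ → ℂ) (hf : DifferentiableOn ℂ f {z : ℂ | 0 < z.re}) (K : ℝ)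
    (hK : ∀ z : ℂ, 0 < z.re → ‖f z‖ ≤ K) :
    ∃ ξ : (ℝ → ℂ) → ℂ, IsTemperedDistRplus ξ ∧
      ∀ u : ℝ, 0 < u → ξ (fun t : ℝ => cexp (-((u : ℂ) * (t : ℂ)))) = f u := by
  have hK0 : 0 ≤ K := (norm_nonneg _).trans (hK 1 (by simp))
  have hne : ∀ z : ℂ, 0 < z.re → (1 + z) ^ 2 ≠ 0 := by
    intro z hz
    apply pow_ne_zero
    intro h
    have := congrArg Complex.re h
    simp at this
    linarith
  obtain ⟨H, hHc, hH0, hHb, hHF⟩ := aux_laplace_inv (fun z => f z / (1 + z) ^ 2)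
    (hf.div (by fun_prop) hne) K (by
      intro z hz
      rw [norm_div, div_eq_mul_inv]
      apply mul_le_mul (hK z hz) _ (by positivity) hK0
      apply inv_anti₀ (by positivity)
      rw [norm_pow, ← Complex.normSq_eq_norm_sq, Complex.normSq_apply]
      simp
      nlinarith)
  set ξ : (ℝ → ℂ) → ℂ := fun φ => ∫ w : ℝ, H w * auxL φ (2 * Real.pi * w) with hξ
  have hbound : ∀ φ ∈ TestSet, ∀ w : ℝ, ‖H w * auxL φ (2 * Real.pi * w)‖ ≤
      (8 * (K * Real.pi) * ∑ j ∈ Finset.range (2 + 1), ∑ m ∈ Finset.range (2 + 1), sNorm j m φ) *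
        (1 + w ^ 2)⁻¹ := by
    intro φ hφ w
    set S := ∑ j ∈ Finset.range (2 + 1), ∑ m ∈ Finset.range (2 + 1), sNorm j m φ with hS
    have hle : ∀ j < 3, ∀ m < 3, sNorm j m φ ≤ S := by
      intro j hj m hm
      calc sNorm j m φ ≤ ∑ m ∈ Finset.range (2 + 1), sNorm j m φ :=
            Finset.single_le_sum (f := fun m => sNorm j m φ)
              (fun i _ => aux_sNorm_nonneg hφ j i) (by simpa using hm)
        _ ≤ S := Finset.single_le_sum (f := fun j => ∑ m ∈ Finset.range (2 + 1), sNorm j m φ)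
              (fun i _ => Finset.sum_nonneg fun m _ => aux_sNorm_nonneg hφ i m) (by simpa using hj)
    have hS0 : 0 ≤ S := (aux_sNorm_nonneg hφ 0 0).trans (hle 0 (by norm_num) 0 (by norm_num))
    rcases lt_or_ge w 0 with hw | hw
    · rw [hH0 w hw]
      simp only [zero_mul, norm_zero]
      positivity
    · have hpi : 1 ≤ 2 * Real.pi := by linarith [Real.pi_gt_three]
      set t := 2 * Real.pi * w with ht
      have ht0 : 0 ≤ t := by positivity
      have hwt : w ≤ t := by rw [ht]; nlinarith
      have hj : ∀ j < 3, (1 + t ^ 2) * ‖iteratedDeriv j φ t‖ ≤ 2 * S := by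
        intro j hj
        have h0 := (aux_le_sNorm hφ j 0 ht0).trans (hle j hj 0 (by norm_num))
        have h2 := (aux_le_sNorm hφ j 2 ht0).trans (hle j hj 2 (by norm_num))
        rw [pow_zero] at h0
        linarith
      have hL : ‖auxL φ t‖ ≤ ‖iteratedDeriv 0 φ t‖ + 2 * ‖iteratedDeriv 1 φ t‖ +
          ‖iteratedDeriv 2 φ t‖ := by
        unfold auxL
        refine (norm_add_le _ _).trans ?_
        gcongr
        refine (norm_sub_le _ _).trans ?_
        simp
      have hL2 : (1 + t ^ 2) * ‖auxL φ t‖ ≤ 8 * S := by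
        have := mul_le_mul_of_nonneg_left hL (by positivity : 0 ≤ 1 + t ^ 2)
        have h0 := hj 0 (by norm_num)
        have h1 := hj 1 (by norm_num)
        have h2 := hj 2 (by norm_num)
        nlinarith
      have hL3 : ‖auxL φ t‖ ≤ 8 * S * (1 + w ^ 2)⁻¹ := by
        rw [← div_eq_mul_inv, le_div_iff₀ (by positivity)]
        have : (1 + w ^ 2) ≤ 1 + t ^ 2 := by gcongr
        nlinarith [norm_nonneg (auxL φ t)]
      rw [norm_mul]
      calc ‖H w‖ * ‖auxL φ t‖ ≤ (K * Real.pi) * (8 * S * (1 + w ^ 2)⁻¹) := by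
            gcongr
            exact hHb w
        _ = _ := by ring
  have hIntegr : ∀ φ ∈ TestSet, Integrable (fun w : ℝ => H w * auxL φ (2 * Real.pi * w)) := by
    intro φ hφ
    refine Integrable.mono' (integrable_inv_one_add_sq.const_mul _) ?_
      (Eventually.of_forall (hbound φ hφ))
    apply Continuous.aestronglyMeasurable
    have h0 := aux_cont_iD hφ 0
    have h1 := aux_cont_iD hφ 1
    have h2 := aux_cont_iD hφ 2
    unfold auxL
    fun_prop
  refine ⟨ξ, ⟨?_, ?_, 2, 8 * (K * Real.pi) * Real.pi, ?_⟩, ?_⟩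
  · intro φ₁ h₁ φ₂ h₂
    simp only [hξ]
    rw [← integral_add (hIntegr φ₁ h₁) (hIntegr φ₂ h₂)]
    congr 1
    ext w
    unfold auxL
    rw [aux_iD_add h₁ h₂, aux_iD_add h₁ h₂, aux_iD_add h₁ h₂]
    ring
  · intro c φ h
    simp only [hξ]
    rw [← integral_const_mul]
    congr 1
    ext w
    unfold auxL
    rw [aux_iD_smul h, aux_iD_smul h, aux_iD_smul h]
    ring
  · intro φ hφ
    simp only [hξ]
    refine (norm_integral_le_of_norm_le (integrable_inv_one_add_sq.const_mul _)
      (Eventually.of_forall (hbound φ hφ))).trans ?_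
    rw [integral_const_mul, integral_univ_inv_one_add_sq]
    apply le_of_eq
    ring
  · intro u hu
    have h1 := hHF u hu
    have h2 := hne u (by simpa using hu)
    rw [eq_div_iff h2] at h1
    rw [← h1, mul_comm, ← integral_const_mul]
    simp only [hξ]
    congr 1
    ext w
    unfold auxL
    rw [aux_iteratedDeriv_exp, aux_iteratedDeriv_exp, aux_iteratedDeriv_exp]
    have : -((u : ℂ) * ((2 * Real.pi * w : ℝ) : ℂ)) = -((2 * Real.pi * u * w : ℝ) : ℂ) := by
      push_cast; ring
    simp only [this]
    ring

end TestSpace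

section Uniqueness
open Filter Topology

/-- The linear span of the exponentials `t ↦ e^{-ut}`, `u > 0`. -/
def auxSpan : Submodule ℂ (ℝ → ℂ) :=
  Submodule.span ℂ {e : ℝ → ℂ | ∃ u : ℝ, 0 < u ∧ e = fun t : ℝ => cexp (-((u : ℂ) * (t : ℂ)))}

lemma aux_zero_mem : (0 : ℝ → ℂ) ∈ TestSet := by
  have := aux_smul_mem (aux_exp_mem one_pos) 0
  simpa using this

lemma aux_span_mem {p : ℝ → ℂ} (hp : p ∈ auxSpan) : p ∈ TestSet := by
  induction hp using Submodule.span_induction with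
  | mem x h => obtain ⟨u, hu, rfl⟩ := h; exact aux_exp_mem hu
  | zero => exact aux_zero_mem
  | add x y _ _ hx hy => exact aux_add_mem hx hy
  | smul a x _ hx => exact aux_smul_mem hx a

lemma aux_span_eq {ξ ξ' : (ℝ → ℂ) → ℂ} (h : IsTemperedDistRplus ξ) (h' : IsTemperedDistRplus ξ')
    (he : ∀ u : ℝ, 0 < u → ξ' (fun t : ℝ => cexp (-((u : ℂ) * (t : ℂ)))) =
      ξ (fun t : ℝ => cexp (-((u : ℂ) * (t : ℂ)))))
    {p : ℝ → ℂ} (hp : p ∈ auxSpan) : ξ' p = ξ p := by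
  induction hp using Submodule.span_induction with
  | mem x h => obtain ⟨u, hu, rfl⟩ := h; exact he u hu
  | zero =>
    have h1 := h.2.1 0 0 aux_zero_mem
    have h2 := h'.2.1 0 0 aux_zero_mem
    simp only [zero_smul, zero_mul] at h1 h2
    rw [h1, h2]
  | add x y hx' hy' hx hy =>
    rw [h.1 x (aux_span_mem hx') y (aux_span_mem hy'),
      h'.1 x (aux_span_mem hx') y (aux_span_mem hy'), hx, hy]
  | smul a x hx' hx => rw [h.2.1 a x (aux_span_mem hx'), h'.2.1 a x (aux_span_mem hx'), hx]

lemma aux_one_add_pow_le (n : ℕ) {t : ℝ} (ht : 0 ≤ t) : (1 + t) ^ n ≤ 2 ^ n * (1 + t ^ n) := by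
  rcases le_total t 1 with h | h
  · calc (1 + t) ^ n ≤ 2 ^ n := by gcongr; linarith
      _ ≤ 2 ^ n * (1 + t ^ n) := by
        apply le_mul_of_one_le_right (by positivity)
        have : 0 ≤ t ^ n := by positivity
        linarith
  · calc (1 + t) ^ n ≤ (2 * t) ^ n := by gcongr; linarith
      _ = 2 ^ n * t ^ n := mul_pow _ _ _
      _ ≤ 2 ^ n * (1 + t ^ n) := by gcongr; linarith

lemma aux_test_decay {φ : ℝ → ℂ} (hφ : φ ∈ TestSet) (N n : ℕ) :
    ∃ C : ℝ, 0 ≤ C ∧ ∀ t : ℝ, 0 ≤ t → (1 + t) ^ n * ‖iteratedDeriv N φ t‖ ≤ C := by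
  refine ⟨2 ^ n * (sNorm N 0 φ + sNorm N n φ), ?_, ?_⟩
  · have := aux_sNorm_nonneg hφ N 0
    have := aux_sNorm_nonneg hφ N n
    positivity
  · intro t ht
    have h0 := aux_le_sNorm hφ N 0 ht
    have h1 := aux_le_sNorm hφ N n ht
    calc (1 + t) ^ n * ‖iteratedDeriv N φ t‖ ≤ 2 ^ n * (1 + t ^ n) * ‖iteratedDeriv N φ t‖ := by
          gcongr; exact aux_one_add_pow_le n ht
      _ = 2 ^ n * (t ^ 0 * ‖iteratedDeriv N φ t‖ + t ^ n * ‖iteratedDeriv N φ t‖) := by ring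
      _ ≤ _ := by gcongr

lemma aux_test_tendsto {φ : ℝ → ℂ} (hφ : φ ∈ TestSet) (N : ℕ) :
    Tendsto (iteratedDeriv N φ) atTop (𝓝 0) := by
  obtain ⟨C, hC0, hC⟩ := aux_test_decay hφ N 1
  have h1 : Tendsto (fun t : ℝ => C * (1 + t)⁻¹) atTop (𝓝 0) := by
    have : Tendsto (fun t : ℝ => (1 + t)⁻¹) atTop (𝓝 0) :=
      tendsto_inv_atTop_zero.comp (tendsto_atTop_add_const_left _ 1 tendsto_id)
    simpa using this.const_mul C
  refine squeeze_zero_norm' ?_ h1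
  filter_upwards [eventually_ge_atTop 0] with t ht
  have := hC t ht
  rw [← div_eq_mul_inv, le_div_iff₀ (by positivity)]
  rw [pow_one] at this
  linarith

/-- Weierstrass approximation in the variable `x = e^{-δt}`. -/
lemma aux_weier (w : ℝ → ℂ) (hw : Continuous w) (h0 : Tendsto w atTop (𝓝 0)) (δ : ℝ) (hδ : 0 < δ)
    (ε : ℝ) (hε : 0 < ε) : ∃ (n : ℕ) (a : ℕ → ℂ), ∀ t : ℝ, 0 ≤ t →
      ‖w t - ∑ i ∈ Finset.range n, a i * (Real.exp (-(δ * t)) : ℂ) ^ i‖ ≤ ε := by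
  set v : ℝ → ℂ := fun x => if x ≤ 0 then 0 else w (-Real.log x / δ) with hv
  have hvc : ContinuousOn v (Set.Icc 0 1) := by
    apply Continuous.continuousOn
    rw [continuous_iff_continuousAt]
    intro x
    rcases lt_trichotomy x 0 with hx | hx | hx
    · have : v =ᶠ[𝓝 x] fun _ => 0 := by
        filter_upwards [Iio_mem_nhds hx] with y hy
        simp only [hv, if_pos (le_of_lt (show y < 0 from hy))]
      exact (continuousAt_const).congr this.symm
    · subst hx
      have hl : Tendsto v (𝓝[≤] 0) (𝓝 0) := by
        apply (tendsto_const_nhds (x := (0 : ℂ))).congr'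
        filter_upwards [self_mem_nhdsWithin] with y hy
        simp only [hv, if_pos (show y ≤ 0 from hy)]
      have hr : Tendsto v (𝓝[>] 0) (𝓝 0) := by
        have h1 : Tendsto (fun x : ℝ => -Real.log x / δ) (𝓝[>] 0) atTop :=
          (tendsto_neg_atBot_atTop.comp Real.tendsto_log_nhdsGT_zero).atTop_div_const hδ
        refine (h0.comp h1).congr' ?_
        filter_upwards [self_mem_nhdsWithin] with y hy
        simp only [hv, if_neg (not_le.2 (show 0 < y from hy)), Function.comp]
      have : v 0 = 0 := by simp [hv]
      rw [ContinuousAt, this]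
      have := hl.sup hr
      rwa [← nhdsLE_sup_nhdsGT (0 : ℝ)]
    · have : v =ᶠ[𝓝 x] fun x => w (-Real.log x / δ) := by
        filter_upwards [Ioi_mem_nhds hx] with y hy
        simp only [hv, if_neg (not_le.2 (show 0 < y from hy))]
      refine ContinuousAt.congr ?_ this.symm
      apply hw.continuousAt.comp
      exact ((Real.continuousAt_log hx.ne').neg).div_const δ
  obtain ⟨p₁, hp₁⟩ := exists_polynomial_near_of_continuousOn 0 1 (fun x => (v x).re)
    (Complex.continuous_re.comp_continuousOn hvc) (ε / 2) (by positivity)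
  obtain ⟨p₂, hp₂⟩ := exists_polynomial_near_of_continuousOn 0 1 (fun x => (v x).im)
    (Complex.continuous_im.comp_continuousOn hvc) (ε / 2) (by positivity)
  refine ⟨max p₁.natDegree p₂.natDegree + 1, fun i => (p₁.coeff i : ℂ) + (p₂.coeff i : ℂ) * I, ?_⟩
  intro t ht
  set x := Real.exp (-(δ * t)) with hx
  have hx0 : 0 < x := Real.exp_pos _
  have hx1 : x ≤ 1 := Real.exp_le_one_iff.2 (by have := mul_nonneg hδ.le ht; linarith)
  have hvx : v x = w t := by
    have : -Real.log x / δ = t := by rw [hx, Real.log_exp]; field_simp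
    simp only [hv, if_neg (not_le.2 hx0), this]
  have h1 := hp₁ x ⟨hx0.le, hx1⟩
  have h2 := hp₂ x ⟨hx0.le, hx1⟩
  have hsum : ∑ i ∈ Finset.range (max p₁.natDegree p₂.natDegree + 1),
      ((p₁.coeff i : ℂ) + (p₂.coeff i : ℂ) * I) * (x : ℂ) ^ i =
      ((p₁.eval x : ℝ) : ℂ) + ((p₂.eval x : ℝ) : ℂ) * I := by
    rw [Polynomial.eval_eq_sum_range' (p := p₁) (n := max p₁.natDegree p₂.natDegree + 1)
      (by omega) x, Polynomial.eval_eq_sum_range' (p := p₂)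
      (n := max p₁.natDegree p₂.natDegree + 1) (by omega) x]
    push_cast
    rw [Finset.sum_mul, ← Finset.sum_add_distrib]
    apply Finset.sum_congr rfl
    intros
    ring
  rw [hsum, ← hvx]
  refine (Complex.norm_le_abs_re_add_abs_im _).trans ?_
  have e1 : (v x - (((p₁.eval x : ℝ) : ℂ) + ((p₂.eval x : ℝ) : ℂ) * I)).re = (v x).re - p₁.eval x := by simp
  have e2 : (v x - (((p₁.eval x : ℝ) : ℂ) + ((p₂.eval x : ℝ) : ℂ) * I)).im = (v x).im - p₂.eval x := by simp
  rw [e1, e2, abs_sub_comm (v x).re, abs_sub_comm (v x).im]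
  linarith

lemma aux_approx {φ : ℝ → ℂ} (hφ : φ ∈ TestSet) (N K : ℕ) (ε : ℝ) (hε : 0 < ε) :
    ∃ p ∈ auxSpan, ∀ t : ℝ, 0 ≤ t →
      (1 + t) ^ K * ‖iteratedDeriv N φ t - iteratedDeriv N p t‖ ≤ ε := by
  obtain ⟨C, hC0, hC⟩ := aux_test_decay hφ N (K + 1)
  set δ := ε / (2 * (C + 1)) with hδd
  have hδ : 0 < δ := by positivity
  set C2 : ℝ := 2 ^ K * (1 + K.factorial / δ ^ K) with hC2
  have hC2p : 0 < C2 := by positivity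
  obtain ⟨n, a, ha⟩ := aux_weier _ (aux_cont_iD hφ N) (aux_test_tendsto hφ N) δ hδ
    (ε / (2 * C2)) (by positivity)
  set u : ℕ → ℝ := fun i => (i + 1) * δ with hu
  have hup : ∀ i, 0 < u i := fun i => by simp only [hu]; positivity
  set e : ℕ → ℝ → ℂ := fun i t => cexp (-((u i : ℂ) * (t : ℂ))) with he
  refine ⟨∑ i ∈ Finset.range n, (a i * ((-(u i : ℂ)) ^ N)⁻¹) • e i, ?_, ?_⟩
  · refine Submodule.sum_mem _ fun i _ => Submodule.smul_mem _ _ (Submodule.subset_span ?_)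
    exact ⟨u i, hup i, rfl⟩
  · intro t ht
    have hD : iteratedDeriv N (∑ i ∈ Finset.range n, (a i * ((-(u i : ℂ)) ^ N)⁻¹) • e i) t =
        (Real.exp (-(δ * t)) : ℂ) *
          ∑ i ∈ Finset.range n, a i * (Real.exp (-(δ * t)) : ℂ) ^ i := by
      rw [iteratedDeriv_sum (fun i _ => aux_cda (aux_smul_mem (aux_exp_mem (hup i)) _) N t),
        Finset.mul_sum]
      apply Finset.sum_congr rfl
      intro i _
      rw [aux_iD_smul (aux_exp_mem (hup i))]
      rw [aux_iteratedDeriv_exp]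
      have hne : (-(u i : ℂ)) ^ N ≠ 0 := by
        apply pow_ne_zero
        rw [neg_ne_zero]
        exact_mod_cast (hup i).ne'
      have h3 : cexp (-((u i : ℂ) * (t : ℂ))) = (Real.exp (-(δ * t)) : ℂ) ^ (i + 1) := by
        push_cast
        rw [← Complex.exp_nat_mul]
        congr 1
        simp only [hu]
        push_cast
        ring
      beta_reduce
      rw [h3]
      field_simp
      ring
    rw [hD]
    set x := Real.exp (-(δ * t)) with hx
    set s := ∑ i ∈ Finset.range n, a i * (x : ℂ) ^ i with hs
    set w := iteratedDeriv N φ t with hw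
    have hx0 : 0 < x := Real.exp_pos _
    have hδt : 0 ≤ δ * t := by positivity
    have hx1 : x ≤ 1 := Real.exp_le_one_iff.2 (by linarith)
    have hx2 : 1 - x ≤ δ * t := by
      have := Real.add_one_le_exp (-(δ * t))
      linarith
    have hsplit : w - x * s = ((1 - x : ℝ) : ℂ) * w + (x : ℂ) * (w - s) := by push_cast; ring
    have hn : ‖w - x * s‖ ≤ (1 - x) * ‖w‖ + x * ‖w - s‖ := by
      rw [hsplit]
      refine (norm_add_le _ _).trans ?_
      rw [norm_mul, norm_mul, Complex.norm_real, Complex.norm_real, Real.norm_eq_abs,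
        Real.norm_eq_abs, abs_of_pos hx0, abs_of_nonneg (by linarith : 0 ≤ 1 - x)]
    have h1 : (1 + t) ^ K * ((1 - x) * ‖w‖) ≤ ε / 2 := by
      calc (1 + t) ^ K * ((1 - x) * ‖w‖) ≤ (1 + t) ^ K * ((δ * (1 + t)) * ‖w‖) := by
            gcongr
            nlinarith
        _ = δ * ((1 + t) ^ (K + 1) * ‖w‖) := by ring
        _ ≤ δ * (C + 1) := by gcongr; linarith [hC t ht]
        _ = ε / 2 := by rw [hδd]; field_simp
    have h2 : (1 + t) ^ K * (x * ‖w - s‖) ≤ ε / 2 := by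
      have h3 : (1 + t) ^ K * x ≤ C2 := by
        calc (1 + t) ^ K * x ≤ 2 ^ K * (1 + t ^ K) * x := by
              gcongr; exact aux_one_add_pow_le K ht
          _ = 2 ^ K * (x + t ^ K * x) := by ring
          _ ≤ C2 := by
            rw [hC2]
            gcongr
            exact aux_pow_mul_exp_le K hδ ht
      calc (1 + t) ^ K * (x * ‖w - s‖) = ((1 + t) ^ K * x) * ‖w - s‖ := by ring
        _ ≤ C2 * (ε / (2 * C2)) := by
          gcongr
          exact ha t ht
        _ = ε / 2 := by field_simp
    calc (1 + t) ^ K * ‖w - x * s‖ ≤ (1 + t) ^ K * ((1 - x) * ‖w‖ + x * ‖w - s‖) := by gcongr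
      _ = (1 + t) ^ K * ((1 - x) * ‖w‖) + (1 + t) ^ K * (x * ‖w - s‖) := by ring
      _ ≤ ε := by linarith

lemma aux_integrate (h : ℝ → ℂ) (h' : ℝ → ℂ) (hd : ∀ t, HasDerivAt h (h' t) t)
    (h0 : Tendsto h atTop (𝓝 0)) (n : ℕ) (ε : ℝ) (hε : 0 < ε)
    (hb : ∀ t : ℝ, 0 ≤ t → ‖h' t‖ ≤ ε * ((1 + t) ^ (n + 2))⁻¹) (t : ℝ) (ht : 0 ≤ t) :
    ‖h t‖ ≤ ε * ((1 + t) ^ (n + 1))⁻¹ := by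
  set B : ℝ → ℝ := fun s => ε * ((1 + t) ^ (n + 1))⁻¹ - ε * ((1 + s) ^ (n + 1))⁻¹ with hB
  have hBd : ∀ s : ℝ, 0 ≤ s → HasDerivAt B (ε * ((n + 1) * ((1 + s) ^ (n + 2))⁻¹)) s := by
    intro s hs
    have h1 : HasDerivAt (fun s : ℝ => (1 + s) ^ (n + 1)) (((n + 1 : ℕ) : ℝ) * (1 + s) ^ n * 1) s :=
      ((hasDerivAt_id s).const_add 1).pow (n + 1)
    have hs1 : (1 + s) ≠ 0 := by positivity
    have h2 := ((h1.inv (pow_ne_zero _ hs1)).const_mul ε).const_sub (ε * ((1 + t) ^ (n + 1))⁻¹)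
    refine h2.congr_deriv ?_
    push_cast
    field_simp
    ring
  have key : ∀ T : ℝ, t ≤ T → ‖h T - h t‖ ≤ ε * ((1 + t) ^ (n + 1))⁻¹ := by
    intro T hT
    have := image_norm_le_of_norm_deriv_right_le_deriv_boundary' (a := t) (b := T)
      (f := fun s => h s - h t) (f' := h') (B := B)
      (B' := fun s => ε * ((n + 1) * ((1 + s) ^ (n + 2))⁻¹))
      (fun s _ => ((hd s).sub_const (h t)).continuousAt.continuousWithinAt)
      (fun s _ => ((hd s).sub_const (h t)).hasDerivWithinAt)
      (by simp [hB])
      (fun s hs => (hBd s (ht.trans hs.1)).continuousAt.continuousWithinAt)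
      (fun s hs => (hBd s (ht.trans hs.1)).hasDerivWithinAt)
      (fun s hs => by
        have hs0 : 0 ≤ s := ht.trans hs.1
        refine (hb s hs0).trans ?_
        gcongr
        apply le_mul_of_one_le_left (by positivity)
        have : (0 : ℝ) ≤ n := Nat.cast_nonneg n
        linarith)
      (⟨hT, le_rfl⟩ : T ∈ Set.Icc t T)
    refine this.trans ?_
    simp only [hB]
    have : 0 ≤ ε * ((1 + T) ^ (n + 1))⁻¹ := by
      have : 0 ≤ 1 + T := by linarith
      positivity
    linarith
  have hlim : Tendsto (fun T => ‖h T - h t‖) atTop (𝓝 ‖0 - h t‖) := (h0.sub_const (h t)).norm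
  have := le_of_tendsto hlim (by
    filter_upwards [eventually_ge_atTop t] with T hT
    exact key T hT)
  simpa using this

lemma aux_dense {φ : ℝ → ℂ} (hφ : φ ∈ TestSet) (k : ℕ) (ε : ℝ) (hε : 0 < ε) :
    ∃ p ∈ auxSpan, ∀ j ≤ k, ∀ m ≤ k, sNorm j m (φ + (-1 : ℂ) • p) ≤ ε := by
  obtain ⟨p, hp, hpt⟩ := aux_approx hφ k (k + 1 + k) ε hε
  have hpT := aux_span_mem hp
  have hh := aux_add_mem hφ (aux_smul_mem hpT (-1))
  refine ⟨p, hp, ?_⟩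
  set h := φ + (-1 : ℂ) • p with hhd
  have key : ∀ i j : ℕ, j + i = k → ∀ t : ℝ, 0 ≤ t →
      ‖iteratedDeriv j h t‖ ≤ ε * ((1 + t) ^ (k + 1 + j))⁻¹ := by
    intro i
    induction i with
    | zero =>
      intro j hj t ht
      obtain rfl : j = k := by omega
      have := hpt t ht
      rw [hhd, aux_iD_add hφ (aux_smul_mem hpT (-1)), aux_iD_smul hpT, neg_one_mul, ← sub_eq_add_neg,
        ← div_eq_mul_inv, le_div_iff₀ (by positivity)]
      linarith
    | succ i ih =>
      intro j hj t ht
      have ih' := ih (j + 1) (by omega)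
      have := aux_integrate (iteratedDeriv j h) (iteratedDeriv (j + 1) h) (fun t => by
        rw [iteratedDeriv_succ]
        apply DifferentiableAt.hasDerivAt
        exact (hh.1.differentiable_iteratedDeriv j (by exact_mod_cast ENat.natCast_lt_top j)) t)
        (aux_test_tendsto hh j) (k + j) ε hε (fun t ht => by
          have := ih' t ht
          rwa [show k + 1 + (j + 1) = k + j + 2 by ring] at this) t ht
      rwa [show k + j + 1 = k + 1 + j by ring] at this
  intro j hj m hm
  apply aux_sNorm_le
  intro t ht
  have h1 := key (k - j) j (by omega) t ht
  rw [← div_eq_mul_inv, le_div_iff₀ (by positivity)] at h1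
  have h2 : t ^ m ≤ (1 + t) ^ (k + 1 + j) := by
    calc t ^ m ≤ (1 + t) ^ m := by gcongr; linarith
      _ ≤ _ := pow_le_pow_right₀ (by linarith) (by omega)
  calc t ^ m * ‖iteratedDeriv j h t‖ ≤ (1 + t) ^ (k + 1 + j) * ‖iteratedDeriv j h t‖ := by gcongr
    _ ≤ ε := by linarith

lemma aux_small {ξ : (ℝ → ℂ) → ℂ} {k : ℕ} {C : ℝ} {φ : ℝ → ℂ} {ε : ℝ}
    (hφ : φ ∈ TestSet)
    (h : ‖ξ φ‖ ≤ C * ∑ j ∈ Finset.range (k + 1), ∑ m ∈ Finset.range (k + 1), sNorm j m φ)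
    (hs : ∀ j ≤ k, ∀ m ≤ k, sNorm j m φ ≤ ε) : ‖ξ φ‖ ≤ |C| * ((k + 1) * ((k + 1) * ε)) := by
  have hS0 : 0 ≤ ∑ j ∈ Finset.range (k + 1), ∑ m ∈ Finset.range (k + 1), sNorm j m φ :=
    Finset.sum_nonneg fun j _ => Finset.sum_nonneg fun m _ => aux_sNorm_nonneg hφ j m
  have hS : ∑ j ∈ Finset.range (k + 1), ∑ m ∈ Finset.range (k + 1), sNorm j m φ ≤
      (k + 1) * ((k + 1) * ε) := by
    calc _ ≤ ∑ j ∈ Finset.range (k + 1), ∑ m ∈ Finset.range (k + 1), ε := by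
          refine Finset.sum_le_sum fun j hj => Finset.sum_le_sum fun m hm => hs j ?_ m ?_
          · exact Nat.lt_succ_iff.1 (Finset.mem_range.1 hj)
          · exact Nat.lt_succ_iff.1 (Finset.mem_range.1 hm)
      _ = _ := by simp
  calc ‖ξ φ‖ ≤ _ := h
    _ ≤ |C| * ∑ j ∈ Finset.range (k + 1), ∑ m ∈ Finset.range (k + 1), sNorm j m φ := by
      gcongr; exact le_abs_self C
    _ ≤ _ := by gcongr

lemma aux_unique {ξ ξ' : (ℝ → ℂ) → ℂ} (h : IsTemperedDistRplus ξ) (h' : IsTemperedDistRplus ξ')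
    (he : ∀ u : ℝ, 0 < u → ξ' (fun t : ℝ => cexp (-((u : ℂ) * (t : ℂ)))) =
      ξ (fun t : ℝ => cexp (-((u : ℂ) * (t : ℂ)))))
    {φ : ℝ → ℂ} (hφ : φ ∈ TestSet) : ξ' φ = ξ φ := by
  obtain ⟨k, C, hC⟩ := h.2.2
  obtain ⟨k', C', hC'⟩ := h'.2.2
  set Q := |C| * ((k + 1) * (k + 1)) + |C'| * ((k' + 1) * (k' + 1)) with hQ
  have hQ0 : 0 ≤ Q := by positivity
  have main : ∀ ε : ℝ, 0 < ε → ‖ξ' φ - ξ φ‖ ≤ Q * ε := by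
    intro ε hε
    obtain ⟨p, hp, hps⟩ := aux_dense hφ (max k k') ε hε
    have hpT := aux_span_mem hp
    have hh := aux_add_mem hφ (aux_smul_mem hpT (-1))
    have h1 := aux_small hh (hC _ hh) (fun j hj m hm => hps j (by omega) m (by omega))
    have h2 := aux_small hh (hC' _ hh) (fun j hj m hm => hps j (by omega) m (by omega))
    have e1 := h.1 φ hφ _ (aux_smul_mem hpT (-1))
    have e2 := h'.1 φ hφ _ (aux_smul_mem hpT (-1))
    rw [h.2.1 _ _ hpT] at e1
    rw [h'.2.1 _ _ hpT, aux_span_eq h h' he hp] at e2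
    have e3 : ξ' φ - ξ φ = ξ' (φ + (-1 : ℂ) • p) - ξ (φ + (-1 : ℂ) • p) := by rw [e1, e2]; ring
    rw [e3]
    refine (norm_sub_le _ _).trans ?_
    rw [hQ]
    linarith
  have hlim : Tendsto (fun ε : ℝ => Q * ε) (𝓝[>] 0) (𝓝 (Q * 0)) :=
    (tendsto_id.mono_left nhdsWithin_le_nhds).const_mul Q
  have := ge_of_tendsto hlim (by
    filter_upwards [self_mem_nhdsWithin] with ε hε
    exact main ε hε)
  rw [mul_zero] at this
  exact sub_eq_zero.1 (norm_le_zero_iff.1 this)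

end Uniqueness

section Nuclear
open Filter Topology

lemma aux_nuclear_rank_one (f : X →L[ℂ] ℂ) (y : X) : IsNuclear (f.smulRight y) := by
  refine ⟨fun k => if k = 0 then f else 0, fun _ => y, ?_, ?_⟩
  · apply summable_of_ne_finset_zero (s := {0})
    intro b hb
    have : b ≠ 0 := by simpa using hb
    simp [this]
  · intro x
    have := hasSum_single (f := fun k : ℕ => (if k = 0 then f else 0) x • y) 0 (by
      intro b hb
      simp [hb])
    simpa using this

lemma aux_nuclearNorm_le {S : X →L[ℂ] X} {f : ℕ → (X →L[ℂ] ℂ)} {y : ℕ → X} {c : ℝ}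
    (h : ∀ x : X, HasSum (fun k => f k x • y k) (S x))
    (hc : HasSum (fun k => ‖f k‖ * ‖y k‖) c) : nuclearNorm S ≤ c := by
  unfold nuclearNorm
  refine csInf_le ⟨0, ?_⟩ (by exact ⟨f, y, h, hc⟩)
  rintro c' ⟨f', y', -, h'⟩
  exact h'.nonneg fun k => by positivity

lemma aux_tr_nat {tr : (X →L[ℂ] X) → ℂ}
    (htr_add : ∀ S R : X →L[ℂ] X, IsNuclear S → IsNuclear R → tr (S + R) = tr S + tr R)
    (htr_norm : ∀ S : X →L[ℂ] X, IsNuclear S → ‖tr S‖ ≤ nuclearNorm S)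
    (htr_rank1 : ∀ (f : X →L[ℂ] ℂ) (y : X), tr (f.smulRight y) = f y)
    {S : X →L[ℂ] X} {f : ℕ → (X →L[ℂ] ℂ)} {y : ℕ → X}
    (hs : Summable (fun k => ‖f k‖ * ‖y k‖))
    (h : ∀ x : X, HasSum (fun k => f k x • y k) (S x)) :
    HasSum (fun k => f k (y k)) (tr S) := by
  set R : ℕ → (X →L[ℂ] X) := fun n => S - ∑ k ∈ Finset.range n, (f k).smulRight (y k) with hR
  have hRh : ∀ n x, HasSum (fun k => f (k + n) x • y (k + n)) (R n x) := by
    intro n x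
    have := (hasSum_nat_add_iff' n).2 (h x)
    simpa [hR, sum_apply] using this
  have hRs : ∀ n, Summable (fun k => ‖f (k + n)‖ * ‖y (k + n)‖) := fun n =>
    (summable_nat_add_iff n).2 hs
  have hRn : ∀ n, IsNuclear (R n) := fun n => ⟨fun k => f (k + n), fun k => y (k + n), hRs n, hRh n⟩
  have hstep : ∀ n, ∑ k ∈ Finset.range n, f k (y k) = tr S - tr (R n) := by
    intro n
    induction n with
    | zero => simp [hR]
    | succ n ih =>
      rw [Finset.sum_range_succ, ih]
      have h1 : R n = (f n).smulRight (y n) + R (n + 1) := by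
        simp only [hR, Finset.sum_range_succ]
        abel
      have h2 := htr_add _ _ (aux_nuclear_rank_one (f n) (y n)) (hRn (n + 1))
      rw [← h1, htr_rank1] at h2
      rw [h2]
      ring
  have h0 : Tendsto (fun n => tr (R n)) atTop (𝓝 0) := by
    refine squeeze_zero_norm (fun n => (htr_norm _ (hRn n)).trans
      (aux_nuclearNorm_le (hRh n) (hRs n).hasSum)) ?_
    exact tendsto_sum_nat_add (fun k => ‖f k‖ * ‖y k‖)
  have hsum : Summable (fun k => ‖f k (y k)‖) :=
    Summable.of_nonneg_of_le (fun _ => norm_nonneg _) (fun k => (f k).le_opNorm (y k)) hs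
  rw [hasSum_iff_tendsto_nat_of_summable_norm hsum]
  simp only [hstep]
  simpa using h0.const_sub (tr S)

lemma aux_tr_countable {tr : (X →L[ℂ] X) → ℂ}
    (htr_add : ∀ S R : X →L[ℂ] X, IsNuclear S → IsNuclear R → tr (S + R) = tr S + tr R)
    (htr_norm : ∀ S : X →L[ℂ] X, IsNuclear S → ‖tr S‖ ≤ nuclearNorm S)
    (htr_rank1 : ∀ (f : X →L[ℂ] ℂ) (y : X), tr (f.smulRight y) = f y)
    {ι : Type*} [Countable ι]
    {D : X →L[ℂ] X} {f : ι → (X →L[ℂ] ℂ)} {y : ι → X}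
    (hs : Summable (fun k => ‖f k‖ * ‖y k‖)) (s : Set X) (hsd : Dense s)
    (h : ∀ x ∈ s, HasSum (fun k => f k x • y k) (D x)) :
    HasSum (fun k => f k (y k)) (tr D) := by
  have hS : Summable (fun k => (f k).smulRight (y k)) := by
    apply Summable.of_norm
    simpa [ContinuousLinearMap.norm_smulRight_apply] using hs
  have hDx : D = ∑' k, (f k).smulRight (y k) := by
    apply ContinuousLinearMap.coeFn_injective
    refine Continuous.ext_on hsd D.continuous (ContinuousLinearMap.continuous _) ?_
    intro x hx
    have h1 := hS.hasSum.mapL (ContinuousLinearMap.apply ℂ X x)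
    have h2 := h x hx
    exact h2.unique (by simpa using h1)
  have hall : ∀ x, HasSum (fun k => f k x • y k) (D x) := by
    intro x
    have h1 := hS.hasSum.mapL (ContinuousLinearMap.apply ℂ X x)
    rw [hDx]
    simpa using h1
  obtain ⟨g, hg⟩ := exists_injective_nat ι
  set f' : ℕ → (X →L[ℂ] ℂ) := Function.extend g f 0 with hf'
  set y' : ℕ → X := Function.extend g y 0 with hy'
  have e1 : ∀ i, f' (g i) = f i := fun i => hg.extend_apply _ _ _
  have e2 : ∀ i, y' (g i) = y i := fun i => hg.extend_apply _ _ _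
  have e3 : ∀ n, n ∉ Set.range g → f' n = 0 := fun n hn => by
    rw [hf', Function.extend_apply' _ _ _ (by simpa using hn)]; rfl
  have := aux_tr_nat htr_add htr_norm htr_rank1 (S := D) (f := f') (y := y') ?_ ?_
  · rw [← hg.hasSum_iff (fun n hn => by simp [e3 n hn])] at this
    simpa [Function.comp_def, e1, e2] using this
  · rw [← hg.summable_iff (fun n hn => by simp [e3 n hn])]
    simpa [Function.comp_def, e1, e2] using hs
  · intro x
    rw [← hg.hasSum_iff (fun n hn => by simp [e3 n hn])]
    simpa [Function.comp_def, e1, e2] using hall x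

end Nuclear

section Decomposition
open Filter Topology

lemma aux_decomp {Ω : Type*} [MeasurableSpace Ω] (ν : Measure Ω) [IsFiniteMeasure ν]
    {E : Type*} [NormedAddCommGroup E] (P : Ω → E) (hP : Integrable P ν) :
    ∃ (T : ℕ → SimpleFunc Ω E), Summable (fun n => ∫ ω, ‖T n ω‖ ∂ν) ∧
      ∀ᵐ ω ∂ν, Summable (fun n => ‖T n ω‖) ∧ HasSum (fun n => T n ω) (P ω) := by
  have hex : ∀ n : ℕ, ∃ s : SimpleFunc Ω E, eLpNorm (P - ⇑s) 1 ν < (2⁻¹ : ENNReal) ^ n ∧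
      MemLp (⇑s) 1 ν := fun n =>
    (memLp_one_iff_integrable.2 hP).exists_simpleFunc_eLpNorm_sub_lt (by simp)
      (pow_ne_zero _ (by simp))
  choose s hs hsm using hex
  have hsi : ∀ n, Integrable (s n) ν := fun n => memLp_one_iff_integrable.1 (hsm n)
  have hdi : ∀ n, Integrable (fun ω => P ω - s n ω) ν := fun n => hP.sub (hsi n)
  have hd : ∀ n, ∫ ω, ‖P ω - s n ω‖ ∂ν ≤ (1 / 2 : ℝ) ^ n := by
    intro n
    have h1 := (hs n).le
    rw [eLpNorm_one_eq_lintegral_enorm] at h1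
    rw [integral_norm_eq_lintegral_enorm (hdi n).aestronglyMeasurable]
    have := ENNReal.toReal_mono (by simp) h1
    simpa using this
  have hgeo : Summable (fun n : ℕ => (1 / 2 : ℝ) ^ n) := summable_geometric_two
  have hae : ∀ᵐ ω ∂ν, Summable (fun n => ‖P ω - s n ω‖) := by
    have h1 : ∫⁻ ω, ∑' n, ‖P ω - s n ω‖ₑ ∂ν ≠ ⊤ := by
      rw [lintegral_tsum (fun n => (hdi n).aestronglyMeasurable.enorm)]
      refine ne_top_of_le_ne_top (b := ∑' n : ℕ, (2⁻¹ : ENNReal) ^ n) ?_ ?_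
      · rw [ENNReal.tsum_geometric]
        simp
      · refine ENNReal.tsum_le_tsum fun n => ?_
        have := (hs n).le
        rw [eLpNorm_one_eq_lintegral_enorm] at this
        exact this
    have h2 := ae_lt_top' (AEMeasurable.ennreal_tsum
      (fun n => (hdi n).aestronglyMeasurable.enorm)) h1
    filter_upwards [h2] with ω hω
    have := ENNReal.summable_toReal hω.ne
    simpa using this
  obtain ⟨T, hT0', hTs'⟩ : ∃ T : ℕ → SimpleFunc Ω E, T 0 = s 0 ∧
      ∀ n, T (n + 1) = s (n + 1) - s n :=
    ⟨fun n => Nat.casesOn n (s 0) (fun n => s (n + 1) - s n), rfl, fun _ => rfl⟩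
  have hT0 : ∀ ω, T 0 ω = s 0 ω := fun ω => by rw [hT0']
  have hTs : ∀ n ω, T (n + 1) ω = s (n + 1) ω - s n ω := fun n ω => by
    rw [hTs', SimpleFunc.sub_apply]
  have hTn : ∀ n ω, ‖T (n + 1) ω‖ ≤ ‖P ω - s (n + 1) ω‖ + ‖P ω - s n ω‖ := by
    intro n ω
    rw [hTs, show s (n + 1) ω - s n ω = (P ω - s n ω) - (P ω - s (n + 1) ω) by abel,
      add_comm ‖P ω - s (n + 1) ω‖]
    exact norm_sub_le (P ω - s n ω) (P ω - s (n + 1) ω)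
  have hTi : ∀ n, Integrable (T n) ν := by
    intro n
    cases n with
    | zero => rw [hT0']; exact hsi 0
    | succ n => rw [hTs', SimpleFunc.coe_sub]; exact (hsi (n + 1)).sub (hsi n)
  refine ⟨T, ?_, ?_⟩
  · rw [← summable_nat_add_iff 1]
    refine Summable.of_nonneg_of_le (fun n => integral_nonneg fun ω => norm_nonneg _) (fun n => ?_)
      (((summable_nat_add_iff 1).2 hgeo).add hgeo)
    calc ∫ ω, ‖T (n + 1) ω‖ ∂ν ≤ ∫ ω, (‖P ω - s (n + 1) ω‖ + ‖P ω - s n ω‖) ∂ν :=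
          integral_mono (hTi _).norm ((hdi _).norm.add (hdi _).norm) (fun ω => hTn n ω)
      _ = ∫ ω, ‖P ω - s (n + 1) ω‖ ∂ν + ∫ ω, ‖P ω - s n ω‖ ∂ν :=
          integral_add (hdi _).norm (hdi _).norm
      _ ≤ _ := add_le_add (hd _) (hd _)
  · filter_upwards [hae] with ω hω
    have hsum : Summable (fun n => ‖T n ω‖) := by
      rw [← summable_nat_add_iff 1]
      exact Summable.of_nonneg_of_le (fun n => norm_nonneg _) (fun n => hTn n ω)
        (((summable_nat_add_iff 1).2 hω).add hω)
    refine ⟨hsum, ?_⟩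
    have hpart : ∀ n, ∑ i ∈ Finset.range (n + 1), T i ω = s n ω := by
      intro n
      induction n with
      | zero => simp [hT0]
      | succ n ih => rw [Finset.sum_range_succ, ih, hTs]; abel
    have hlim : Tendsto (fun n => s n ω) atTop (𝓝 (P ω)) := by
      have h1 := hω.tendsto_atTop_zero
      rw [tendsto_iff_norm_sub_tendsto_zero]
      simpa [norm_sub_rev] using h1
    have hlim2 : Tendsto (fun n => ∑ i ∈ Finset.range n, T i ω) atTop (𝓝 (P ω)) := by
      rw [← tendsto_add_atTop_iff_nat 1]
      simpa only [hpart] using hlim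
    exact hasSum_of_subseq_of_summable hsum tendsto_finset_range hlim2

lemma aux_decomp2.{u, v} {Ω : Type v} [MeasurableSpace Ω] (ν : Measure Ω) [IsFiniteMeasure ν]
    {E : Type u} [NormedAddCommGroup E] [CompleteSpace E] (P : Ω → E) (hP : Integrable P ν) :
    ∃ (ι : Type u) (_ : Countable ι) (c : ι → E) (F : ι → Set Ω), (∀ i, MeasurableSet (F i)) ∧
      Summable (fun i => ‖c i‖ * ν.real (F i)) ∧
      ∀ᵐ ω ∂ν, HasSum (fun i => (F i).indicator (fun _ => c i) ω) (P ω) := by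
  obtain ⟨T, hT, hTae⟩ := aux_decomp ν P hP
  refine ⟨Σ n : ℕ, {v : E // v ∈ (T n).range}, inferInstance, fun i => i.2.1,
    fun i => (T i.1) ⁻¹' {i.2.1}, fun i => (T i.1).measurableSet_fiber _, ?_, ?_⟩
  · rw [summable_sigma_of_nonneg (fun i => by positivity)]
    refine ⟨fun n => Summable.of_finite, ?_⟩
    convert! hT using 2 with n
    rw [tsum_fintype]
    have h1 : ∀ ω, ‖T n ω‖ = ∑ v : {v : E // v ∈ (T n).range},
        ((T n) ⁻¹' {v.1}).indicator (fun _ => ‖v.1‖) ω := by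
      intro ω
      rw [Finset.sum_eq_single ⟨T n ω, (T n).mem_range_self ω⟩]
      · simp
      · intro v _ hv
        apply Set.indicator_of_notMem
        intro h
        apply hv
        ext
        exact h.symm
      · simp
    simp_rw [h1]
    rw [integral_finsetSum _ (fun v _ =>
      (integrable_const _).indicator ((T n).measurableSet_fiber _))]
    refine Finset.sum_congr rfl fun v _ => ?_
    rw [integral_indicator_const _ ((T n).measurableSet_fiber _), smul_eq_mul, mul_comm]
  · filter_upwards [hTae] with ω hω
    have hfib : ∀ n : ℕ, ∀ (b : {v : E // v ∈ (T n).range}),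
        b ≠ ⟨T n ω, (T n).mem_range_self ω⟩ →
        ((T n) ⁻¹' {b.1}).indicator (fun _ => b.1) ω = 0 := by
      intro n b hb
      apply Set.indicator_of_notMem
      intro h
      apply hb
      ext
      exact h.symm
    refine HasSum.sigma_of_hasSum hω.2 (fun n => ?_) ?_
    · have := hasSum_single (f := fun b : {v : E // v ∈ (T n).range} =>
        ((T n) ⁻¹' {b.1}).indicator (fun _ => b.1) ω) _ (hfib n)
      simpa using this
    · apply Summable.of_norm
      rw [summable_sigma_of_nonneg (fun i => norm_nonneg _)]
      refine ⟨fun n => Summable.of_finite, ?_⟩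
      convert! hω.1 using 2 with n
      rw [tsum_eq_single _ (fun b hb => by rw [hfib n b hb, norm_zero])]
      simp

lemma aux_decomp3 {Ω : Type*} [MeasurableSpace Ω] (ν : Measure Ω) [IsFiniteMeasure ν]
    {E : Type*} [NormedAddCommGroup E] [NormedSpace ℂ E] {P : Ω → E}
    {G : Type*} [NormedAddCommGroup G] [NormedSpace ℂ G]
    {ι : Type*} [Countable ι] {c : ι → E} {F : ι → Set Ω} (hF : ∀ i, MeasurableSet (F i))
    (hs : Summable (fun i => ‖c i‖ * ν.real (F i)))
    (hae : ∀ᵐ ω ∂ν, HasSum (fun i => (F i).indicator (fun _ => c i) ω) (P ω))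
    (b : Ω → (E →L[ℂ] G)) (hb : AEStronglyMeasurable b ν) (C : ℝ) (hC : ∀ᵐ ω ∂ν, ‖b ω‖ ≤ C) :
    HasSum (fun i => ∫ ω in F i, b ω (c i) ∂ν) (∫ ω, b ω (P ω) ∂ν) := by
  have hm : ∀ i, AEStronglyMeasurable (fun ω => b ω (c i)) ν := fun i =>
    (ContinuousLinearMap.apply ℂ G (c i)).continuous.comp_aestronglyMeasurable hb
  have hi : ∀ i, Integrable (fun ω => b ω (c i)) ν := by
    intro i
    refine Integrable.mono' (integrable_const (C * ‖c i‖)) (hm i) ?_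
    filter_upwards [hC] with ω hω
    exact (b ω).le_of_opNorm_le hω _
  have h1 := hasSum_integral_of_summable_integral_norm (μ := ν)
    (F := fun i ω => (F i).indicator (fun ω => b ω (c i)) ω)
    (fun i => (hi i).indicator (hF i)) ?_
  · have e1 : ∀ i, ∫ ω, (F i).indicator (fun ω => b ω (c i)) ω ∂ν =
        ∫ ω in F i, b ω (c i) ∂ν := fun i => integral_indicator (hF i)
    have e2 : ∫ ω, ∑' i, (F i).indicator (fun ω => b ω (c i)) ω ∂ν = ∫ ω, b ω (P ω) ∂ν := by
      apply integral_congr_ae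
      filter_upwards [hae] with ω hω
      have := hω.mapL (b ω)
      rw [← this.tsum_eq]
      congr 1
      ext i
      by_cases h : ω ∈ F i <;> simp [h]
    simp only [e1, e2] at h1
    exact h1
  · refine Summable.of_nonneg_of_le (fun i => integral_nonneg fun ω => norm_nonneg _) (fun i => ?_)
      (hs.mul_left C)
    simp only [norm_indicator_eq_indicator_norm]
    rw [integral_indicator (hF i)]
    calc ∫ ω in F i, ‖b ω (c i)‖ ∂ν ≤ ∫ ω in F i, C * ‖c i‖ ∂ν := by
          apply integral_mono_ae (hi i).norm.integrableOn (integrable_const _)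
          filter_upwards [ae_restrict_of_ae hC] with ω hω
          exact (b ω).le_of_opNorm_le hω _
      _ = C * (‖c i‖ * ν.real (F i)) := by
        rw [setIntegral_const, smul_eq_mul]; ring

end Decomposition
section Core
open Filter Topology

lemma aux_theta {f : ℕ → (X →L[ℂ] ℂ)} {y : ℕ → X}
    (hs : Summable (fun k => ‖f k‖ * ‖y k‖)) :
    ∃ θ : (X →L[ℂ] X) →L[ℂ] ℂ, ∀ R : X →L[ℂ] X, HasSum (fun k => f k (R (y k))) (θ R) := by
  have hsum : Summable (fun k => (f k).comp (ContinuousLinearMap.apply ℂ X (y k))) := by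
    apply Summable.of_norm
    refine Summable.of_nonneg_of_le (fun _ => norm_nonneg _) (fun k => ?_) hs
    refine ContinuousLinearMap.opNorm_le_bound _ (by positivity) fun R => ?_
    calc ‖f k (R (y k))‖ ≤ ‖f k‖ * (‖R‖ * ‖y k‖) :=
          (f k).le_opNorm_of_le (R.le_opNorm _)
      _ = _ := by ring
  refine ⟨∑' k, (f k).comp (ContinuousLinearMap.apply ℂ X (y k)), fun R => ?_⟩
  have := hsum.hasSum.mapL (ContinuousLinearMap.apply ℂ ℂ R)
  simpa using this

lemma aux_core {tr : (X →L[ℂ] X) → ℂ}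
    (htr_add : ∀ S R : X →L[ℂ] X, IsNuclear S → IsNuclear R → tr (S + R) = tr S + tr R)
    (htr_norm : ∀ S : X →L[ℂ] X, IsNuclear S → ‖tr S‖ ≤ nuclearNorm S)
    (htr_rank1 : ∀ (f : X →L[ℂ] ℂ) (y : X), tr (f.smulRight y) = f y)
    {Δ : X →L[ℂ] X} {f : ℕ → (X →L[ℂ] ℂ)} {y : ℕ → X}
    (hs : Summable (fun k => ‖f k‖ * ‖y k‖)) (hΔ : ∀ x : X, HasSum (fun k => f k x • y k) (Δ x))
    {θ : (X →L[ℂ] X) →L[ℂ] ℂ} (hθ : ∀ R : X →L[ℂ] X, HasSum (fun k => f k (R (y k))) (θ R))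
    {Ω : Type*} [MeasurableSpace Ω] (ν : Measure Ω) [IsFiniteMeasure ν]
    {P Q : Ω → (X →L[ℂ] X)} (hP : AEStronglyMeasurable P ν) (hQ : AEStronglyMeasurable Q ν)
    {M : ℝ} (hPM : ∀ᵐ ω ∂ν, ‖P ω‖ ≤ M) (hQM : ∀ᵐ ω ∂ν, ‖Q ω‖ ≤ M)
    {D : X →L[ℂ] X} (s : Set X) (hsd : Dense s)
    (hD : ∀ x ∈ s, D x = ∫ ω, P ω (Δ (Q ω x)) ∂ν) :
    tr D = ∫ ω, θ ((Q ω).comp (P ω)) ∂ν := by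
  have hPi : Integrable P ν := Integrable.mono' (integrable_const M) hP hPM
  have hQi : Integrable Q ν := Integrable.mono' (integrable_const M) hQ hQM
  obtain ⟨ι, hι, c, F, hF, hcs, hae⟩ := aux_decomp2 ν P hPi
  set q : ι → (X →L[ℂ] X) := fun i => ∫ ω in F i, Q ω ∂ν with hq
  have hqn : ∀ i, ‖q i‖ ≤ M * ν.real (F i) := fun i =>
    norm_setIntegral_le_of_norm_le_const_ae' (measure_lt_top _ _)
      (hQM.mono fun ω h _ => h)
  -- the two series
  have hS0 : Summable (fun p : ι × ℕ => (‖c p.1‖ * (M * ν.real (F p.1))) * (‖f p.2‖ * ‖y p.2‖)) := by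
    have h1 : Summable (fun i => ‖c i‖ * (M * ν.real (F i))) := by
      refine (hcs.mul_left M).congr fun i => by ring
    exact h1.mul_of_nonneg hs
      (fun i => mul_nonneg (norm_nonneg _) ((norm_nonneg _).trans (hqn i)))
      (fun k => by positivity)
  have hS : Summable (fun p : ι × ℕ => ‖(f p.2).comp (q p.1)‖ * ‖c p.1 (y p.2)‖) := by
    refine Summable.of_nonneg_of_le (fun _ => by positivity) (fun p => ?_) hS0
    calc ‖(f p.2).comp (q p.1)‖ * ‖c p.1 (y p.2)‖
        ≤ (‖f p.2‖ * (M * ν.real (F p.1))) * (‖c p.1‖ * ‖y p.2‖) := by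
          refine mul_le_mul ?_ (le_opNorm _ _) (norm_nonneg _)
            (mul_nonneg (norm_nonneg _) ((norm_nonneg _).trans (hqn p.1)))
          exact (opNorm_comp_le _ _).trans
            (mul_le_mul_of_nonneg_left (hqn p.1) (norm_nonneg _))
      _ = _ := by ring
  have key : ∀ x ∈ s, HasSum (fun p : ι × ℕ => ((f p.2).comp (q p.1)) x • c p.1 (y p.2)) (D x) := by
    intro x hx
    have hsum : Summable (fun p : ι × ℕ => ((f p.2).comp (q p.1)) x • c p.1 (y p.2)) := by
      apply Summable.of_norm
      refine Summable.of_nonneg_of_le (fun _ => norm_nonneg _) (fun p => ?_) (hS.mul_left ‖x‖)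
      rw [norm_smul]
      calc _ ≤ (‖(f p.2).comp (q p.1)‖ * ‖x‖) * ‖c p.1 (y p.2)‖ := by
            gcongr; exact le_opNorm _ _
        _ = _ := by ring
    have h1 := hsum.hasSum.prod_fiberwise (g := fun i => c i (Δ (q i x))) (fun i => by
      have := (hΔ (q i x)).mapL (c i)
      simpa using this)
    have h2 := aux_decomp3 ν hF hcs hae (fun ω => ContinuousLinearMap.apply ℂ X (Δ (Q ω x)))
      ((ContinuousLinearMap.apply ℂ X).continuous.comp_aestronglyMeasurable
        (Δ.continuous.comp_aestronglyMeasurable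
          ((ContinuousLinearMap.apply ℂ X x).continuous.comp_aestronglyMeasurable hQ)))
      (‖Δ‖ * (M * ‖x‖)) (by
        filter_upwards [hQM] with ω hω
        refine (ContinuousLinearMap.opNorm_le_bound _ (norm_nonneg _) (fun R => ?_)).trans
          (Δ.le_opNorm_of_le ((Q ω).le_of_opNorm_le hω x))
        rw [mul_comm]
        exact le_opNorm R _)
    simp only [ContinuousLinearMap.apply_apply] at h2
    have h3 : ∀ i, ∫ ω in F i, c i (Δ (Q ω x)) ∂ν = c i (Δ (q i x)) := by
      intro i
      have e1 : q i x = ∫ ω in F i, Q ω x ∂ν :=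
        ContinuousLinearMap.integral_apply hQi.integrableOn x
      have := ((c i).comp Δ).integral_comp_comm
        (((ContinuousLinearMap.apply ℂ X x).integrable_comp hQi).integrableOn (s := F i))
      rw [e1]
      simpa using this
    simp only [h3] at h2
    rw [← hD x hx] at h2
    have := h1.unique h2
    rw [← this]
    exact hsum.hasSum
  have htr := aux_tr_countable htr_add htr_norm htr_rank1 hS s hsd key
  have h1 := htr.prod_fiberwise (g := fun i => θ ((q i).comp (c i))) (fun i => by
    simpa using hθ ((q i).comp (c i)))
  have h2 := aux_decomp3 ν hF hcs hae
    (fun ω => θ.comp (compL ℂ X X X (Q ω)))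
    (by
      have hc : Continuous (fun R : X →L[ℂ] X => θ.comp (compL ℂ X X X R)) := by fun_prop
      exact hc.comp_aestronglyMeasurable hQ)
    (‖θ‖ * M) (by
      filter_upwards [hQM] with ω hω
      refine ContinuousLinearMap.opNorm_le_bound _
        (mul_nonneg (opNorm_nonneg θ) ((norm_nonneg _).trans hω)) (fun R => ?_)
      simp only [ContinuousLinearMap.comp_apply, compL_apply]
      rw [mul_assoc]
      exact θ.le_opNorm_of_le ((opNorm_comp_le _ _).trans (by gcongr)))
  simp only [ContinuousLinearMap.comp_apply, compL_apply] at h2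
  have h3 : ∀ i, ∫ ω in F i, θ ((Q ω).comp (c i)) ∂ν = θ ((q i).comp (c i)) := by
    intro i
    have := (θ.comp ((compL ℂ X X X).flip (c i))).integral_comp_comm
      (hQi.integrableOn (s := F i))
    simpa using this
  simp only [h3] at h2
  exact h1.unique h2

end Core
section Duhamel
open Filter Topology

lemma aux_hasDerivAt_T (G : HoloGen X) {t : ℝ} (ht : 0 < t) :
    HasDerivAt (fun s : ℝ => G.T (s : ℂ)) (deriv G.T (t : ℂ)) t := by
  have h : DifferentiableAt ℂ G.T (t : ℂ) :=
    G.holo.differentiableAt ((isOpen_lt continuous_const Complex.continuous_re).mem_nhds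
      (by simpa using ht))
  have h2 := h.hasDerivAt.scomp t Complex.ofRealCLM.hasDerivAt
  rw [Complex.ofRealCLM_apply, Complex.ofReal_one, one_smul] at h2
  exact h2

lemma aux_hasDerivAt_Tx (G : HoloGen X) {t : ℝ} (ht : 0 < t) (x : X) :
    HasDerivAt (fun s : ℝ => G.T (s : ℂ) x) (deriv G.T (t : ℂ) x) t :=
  ((ContinuousLinearMap.apply ℂ X x).restrictScalars ℝ).hasFDerivAt.comp_hasDerivAt t
    (aux_hasDerivAt_T G ht)

lemma aux_T_quot (G : HoloGen X) {t : ℝ} (ht : 0 < t) (x : X) :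
    Tendsto (fun h : ℝ => (h : ℂ)⁻¹ • (G.T ((t + h : ℝ) : ℂ) x - G.T (t : ℂ) x))
      (𝓝[>] 0) (𝓝 (deriv G.T (t : ℂ) x)) := by
  have h1 : HasDerivAt (fun s : ℝ => G.T (s : ℂ) x) (deriv G.T (t : ℂ) x) t :=
    aux_hasDerivAt_Tx G ht x
  have h2 := h1.tendsto_slope_zero_right
  refine h2.congr fun h => ?_
  rw [← Complex.coe_smul, Complex.ofReal_inv]

lemma aux_T_mem (G : HoloGen X) {t : ℝ} (ht : 0 < t) (x : X) :
    G.T (t : ℂ) x ∈ G.dom ∧ G.gen (G.T (t : ℂ) x) = deriv G.T (t : ℂ) x := by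
  have h1 : Tendsto (fun h : ℝ => (h : ℂ)⁻¹ • (G.T (h : ℂ) (G.T (t : ℂ) x) - G.T (t : ℂ) x))
      (𝓝[>] 0) (𝓝 (deriv G.T (t : ℂ) x)) := by
    refine (aux_T_quot G ht x).congr' ?_
    filter_upwards [self_mem_nhdsWithin] with h hh
    rw [add_comm t h, G.T_add_real (le_of_lt hh) ht.le]
    rfl
  have hm : G.T (t : ℂ) x ∈ G.dom := (G.mem_dom_iff _).2 ⟨_, h1⟩
  exact ⟨hm, tendsto_nhds_unique (G.gen_spec _ hm) h1⟩

lemma aux_T_gen (G : HoloGen X) {t : ℝ} (ht : 0 < t) {y : X} (hy : y ∈ G.dom) :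
    deriv G.T (t : ℂ) y = G.T (t : ℂ) (G.gen y) := by
  have h1 := ((G.T (t : ℂ)).continuous.tendsto _).comp (G.gen_spec y hy)
  refine tendsto_nhds_unique (aux_T_quot G ht y) (h1.congr' ?_)
  filter_upwards [self_mem_nhdsWithin] with h hh
  rw [G.T_add_real ht.le (le_of_lt hh)]
  simp

lemma aux_cont {S : Set ℝ} {a : ℝ → (X →L[ℂ] X)} {v : ℝ → X} {K : ℝ}
    (haK : ∀ s ∈ S, ‖a s‖ ≤ K) (ha : ∀ x, ContinuousOn (fun s => a s x) S)
    (hv : ContinuousOn v S) : ContinuousOn (fun s => a s (v s)) S := by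
  intro s0 hs0
  have h1 : Tendsto (fun s => a s (v s - v s0)) (𝓝[S] s0) (𝓝 0) := by
    have hv' : Tendsto (fun s => K * ‖v s - v s0‖) (𝓝[S] s0) (𝓝 0) := by
      have := (tendsto_iff_norm_sub_tendsto_zero.1 (hv s0 hs0)).const_mul K
      simpa using this
    refine squeeze_zero_norm' ?_ hv'
    filter_upwards [self_mem_nhdsWithin] with s hs
    exact (a s).le_of_opNorm_le (haK s hs) _
  have h2 := h1.add (ha (v s0) s0 hs0)
  simp only [map_sub, sub_add_cancel, zero_add] at h2
  exact h2

lemma aux_norm_T (G : HoloGen X) {M : ℝ} (hM : ∀ z : ℂ, 0 < z.re → ‖G.T z‖ ≤ M) {t : ℝ}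
    (ht : 0 ≤ t) : ‖G.T (t : ℂ)‖ ≤ max M 1 := by
  rcases ht.eq_or_lt with rfl | h
  · rw [Complex.ofReal_zero, G.T_zero]
    exact norm_id_le.trans (le_max_right _ _)
  · exact (hM _ (by simpa using h)).trans (le_max_left _ _)

lemma aux_duhamel (A B : HoloGen X) {M : ℝ}
    (hMA : ∀ z : ℂ, 0 < z.re → ‖A.T z‖ ≤ M)
    (hdom : A.dom = B.dom)
    (Δ : X →L[ℂ] X) (hΔ : ∀ x ∈ A.dom, Δ x = A.gen x - B.gen x) {u : ℝ} (hu : 0 < u) (x : X) :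
    A.T (u : ℂ) x - B.T (u : ℂ) x =
      u • ∫ s in Set.Ioo (0 : ℝ) 1, A.T ((u * (1 - s) : ℝ) : ℂ) (Δ (B.T ((u * s : ℝ) : ℂ) x)) := by
  have hAc : ∀ x, ContinuousOn (fun s : ℝ => A.T ((u * (1 - s) : ℝ) : ℂ) x) (Set.Icc 0 1) := by
    intro x
    exact (A.strong_cont x).comp (f := fun s : ℝ => u * (1 - s)) (by fun_prop)
      (fun s hs => mul_nonneg hu.le (by linarith [hs.2]))
  have hBc : ∀ x, ContinuousOn (fun s : ℝ => B.T ((u * s : ℝ) : ℂ) x) (Set.Icc 0 1) := by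
    intro x
    exact (B.strong_cont x).comp (f := fun s : ℝ => u * s) (by fun_prop)
      (fun s hs => mul_nonneg hu.le hs.1)
  have hAn : ∀ s ∈ Set.Icc (0 : ℝ) 1, ‖A.T ((u * (1 - s) : ℝ) : ℂ)‖ ≤ max M 1 := fun s hs =>
    aux_norm_T A hMA (mul_nonneg hu.le (by linarith [hs.2]))
  have hg : ContinuousOn (fun s : ℝ => A.T ((u * (1 - s) : ℝ) : ℂ) (B.T ((u * s : ℝ) : ℂ) x))
      (Set.Icc 0 1) := aux_cont hAn hAc (hBc x)
  have hg' : ContinuousOn (fun s : ℝ => A.T ((u * (1 - s) : ℝ) : ℂ)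
      (Δ (B.T ((u * s : ℝ) : ℂ) x))) (Set.Icc 0 1) :=
    aux_cont hAn hAc (Δ.continuous.comp_continuousOn (hBc x))
  have hder : ∀ s ∈ Set.Ioo (0 : ℝ) 1,
      HasDerivAt (fun s : ℝ => A.T ((u * (1 - s) : ℝ) : ℂ) (B.T ((u * s : ℝ) : ℂ) x))
        (-(u • A.T ((u * (1 - s) : ℝ) : ℂ) (Δ (B.T ((u * s : ℝ) : ℂ) x)))) s := by
    intro s hs
    have hs1 : 0 < u * (1 - s) := mul_pos hu (by linarith [hs.2])
    have hs2 : 0 < u * s := mul_pos hu hs.1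
    have d1 : HasDerivAt (fun s : ℝ => A.T ((u * (1 - s) : ℝ) : ℂ))
        ((-u) • deriv A.T ((u * (1 - s) : ℝ) : ℂ)) s := by
      have hl : HasDerivAt (fun s : ℝ => u * (1 - s)) (-u) s := by
        simpa using ((hasDerivAt_id s).const_sub 1).const_mul u
      exact (aux_hasDerivAt_T A hs1).scomp s hl
    have d2 : HasDerivAt (fun s : ℝ => B.T ((u * s : ℝ) : ℂ) x)
        (u • deriv B.T ((u * s : ℝ) : ℂ) x) s := by
      have hl : HasDerivAt (fun s : ℝ => u * s) u s := by
        simpa using (hasDerivAt_id s).const_mul u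
      exact (aux_hasDerivAt_Tx B hs2 x).scomp s hl
    have d3 := (((restrictScalarsL ℂ X X ℝ ℝ).hasFDerivAt.comp_hasDerivAt s d1)).clm_apply d2
    have hm := aux_T_mem B hs2 x
    have hmA : B.T ((u * s : ℝ) : ℂ) x ∈ A.dom := hdom ▸ hm.1
    convert! d3 using 1
    change _ = ((-u) • deriv A.T ((u * (1 - s) : ℝ) : ℂ) (B.T ((u * s : ℝ) : ℂ) x)) +
      A.T ((u * (1 - s) : ℝ) : ℂ) (u • deriv B.T ((u * s : ℝ) : ℂ) x)
    rw [aux_T_gen A hs1 hmA, hΔ _ hmA, ← hm.2, map_sub, map_smul_of_tower]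
    module
  have hIntegr := intervalIntegral.integral_eq_sub_of_hasDerivAt_of_le zero_le_one hg hder (by
    apply ContinuousOn.intervalIntegrable_of_Icc zero_le_one
    exact (hg'.const_smul u).neg)
  rw [intervalIntegral.integral_neg, intervalIntegral.integral_smul,
    intervalIntegral.integral_of_le zero_le_one, integral_Ioc_eq_integral_Ioo] at hIntegr
  simp only [mul_one, sub_self, mul_zero, Complex.ofReal_zero, A.T_zero, B.T_zero, sub_zero,
    one_apply_eq_self] at hIntegr
  rw [← neg_sub, ← hIntegr, neg_neg]

end Duhamel
section Holo
open Filter Topology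

lemma aux_holo_integral {Ω : Type*} [MeasurableSpace Ω] (ν : Measure Ω) [IsFiniteMeasure ν]
    (h : ℂ → Ω → ℂ) (K : ℝ) (hm : ∀ z : ℂ, 0 < z.re → AEStronglyMeasurable (h z) ν)
    (hd : ∀ᵐ ω ∂ν, DifferentiableOn ℂ (fun z => h z ω) {z : ℂ | 0 < z.re})
    (hK : ∀ᵐ ω ∂ν, ∀ z : ℂ, 0 < z.re → ‖h z ω‖ ≤ K) :
    DifferentiableOn ℂ (fun z => ∫ ω, h z ω ∂ν) {z : ℂ | 0 < z.re} := by
  have hopen : IsOpen {z : ℂ | 0 < z.re} := isOpen_lt continuous_const Complex.continuous_re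
  intro z0 hz0
  have hz0' : 0 < z0.re := hz0
  have hre : ∀ z w : ℂ, w.re - dist z w ≤ z.re := by
    intro z w
    have := (Complex.abs_re_le_norm (z - w))
    rw [← dist_eq_norm, Complex.sub_re] at this
    linarith [neg_abs_le (z.re - w.re)]
  have hball : ∀ z ∈ Metric.ball z0 (z0.re / 2), z0.re / 2 < z.re := by
    intro z hz
    have := hre z z0
    have := Metric.mem_ball.1 hz
    linarith
  have hmeas : AEStronglyMeasurable (fun ω => deriv (fun z => h z ω) z0) ν := by
    have hpos : ∀ n : ℕ, (0 : ℝ) < 1 / ((n : ℝ) + 1) := fun n => by positivity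
    refine aestronglyMeasurable_of_tendsto_ae atTop
      (f := fun (n : ℕ) ω => ((1 / ((n : ℝ) + 1) : ℝ) : ℂ)⁻¹ •
        (h (z0 + ((1 / ((n : ℝ) + 1) : ℝ) : ℂ)) ω - h z0 ω)) (fun n => ?_) ?_
    · have hp : 0 < (z0 + ((1 / ((n : ℝ) + 1) : ℝ) : ℂ)).re := by
        rw [Complex.add_re, Complex.ofReal_re]
        exact add_pos hz0' (hpos n)
      exact ((hm _ hp).sub (hm _ hz0)).const_smul ((1 / ((n : ℝ) + 1) : ℝ) : ℂ)⁻¹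
    · filter_upwards [hd] with ω hω
      have h1 := ((hω.differentiableAt (hopen.mem_nhds hz0)).hasDerivAt).tendsto_slope_zero
      refine h1.comp (tendsto_nhdsWithin_iff.2 ⟨?_, ?_⟩)
      · have := (Complex.continuous_ofReal.tendsto 0).comp tendsto_one_div_add_atTop_nhds_zero_nat
        rw [Complex.ofReal_zero] at this
        exact this
      · filter_upwards with n
        exact Complex.ofReal_ne_zero.2 (hpos n).ne'
  have := hasDerivAt_integral_of_dominated_loc_of_deriv_le (μ := ν) (F := h)
    (F' := fun z ω => deriv (fun z => h z ω) z) (x₀ := z0)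
    (s := Metric.ball z0 (z0.re / 2)) (bound := fun _ => K / (z0.re / 4))
    (Metric.ball_mem_nhds _ (by linarith)) ?_ ?_ hmeas ?_ (integrable_const _) ?_
  · exact this.2.differentiableAt.differentiableWithinAt
  · filter_upwards [hopen.mem_nhds hz0] with z hz
    exact hm z hz
  · refine Integrable.mono' (integrable_const K) (hm z0 hz0) ?_
    filter_upwards [hK] with ω hω
    exact hω z0 hz0
  · filter_upwards [hd, hK] with ω hω hωK z hz
    have hz1 := hball z hz
    have hsub : Metric.closedBall z (z0.re / 4) ⊆ {z : ℂ | 0 < z.re} := by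
      intro w hw
      have h1 := hre w z
      have h2 := Metric.mem_closedBall.1 hw
      change 0 < w.re
      linarith
    apply Complex.norm_deriv_le_of_forall_mem_sphere_norm_le (by linarith)
    · apply DifferentiableOn.diffContOnCl
      rw [closure_ball _ (by linarith)]
      exact hω.mono hsub
    · intro w hw
      exact hωK w (hsub (Metric.sphere_subset_closedBall hw))
  · filter_upwards [hd] with ω hω z hz
    exact (hω.differentiableAt (hopen.mem_nhds (by
      have := hball z hz
      change 0 < z.re
      linarith))).hasDerivAt

lemma aux_f (A B : HoloGen X) {M : ℝ}
    (hMA : ∀ z : ℂ, 0 < z.re → ‖A.T z‖ ≤ M)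
    (hMB : ∀ z : ℂ, 0 < z.re → ‖B.T z‖ ≤ M)
    (θ : (X →L[ℂ] X) →L[ℂ] ℂ) :
    DifferentiableOn ℂ (fun z : ℂ => ∫ s in Set.Ioo (0 : ℝ) 1,
      θ ((B.T (z * (s : ℂ))).comp (A.T (z * ((1 - s : ℝ) : ℂ))))) {z : ℂ | 0 < z.re} ∧
    ∀ z : ℂ, 0 < z.re → ‖∫ s in Set.Ioo (0 : ℝ) 1,
      θ ((B.T (z * (s : ℂ))).comp (A.T (z * ((1 - s : ℝ) : ℂ))))‖ ≤ ‖θ‖ * (M * M) := by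
  have hM : 0 ≤ M := (norm_nonneg _).trans (hMA 1 (by simp))
  have hre : ∀ (z : ℂ) (s : ℝ), 0 < z.re → 0 < s → 0 < (z * (s : ℂ)).re := by
    intro z s hz hs
    rw [Complex.re_mul_ofReal]
    exact mul_pos hz hs
  have hbd : ∀ s ∈ Set.Ioo (0 : ℝ) 1, ∀ z : ℂ, 0 < z.re →
      ‖θ ((B.T (z * (s : ℂ))).comp (A.T (z * ((1 - s : ℝ) : ℂ))))‖ ≤ ‖θ‖ * (M * M) := by
    intro s hs z hz
    refine θ.le_opNorm_of_le ((opNorm_comp_le _ _).trans ?_)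
    exact mul_le_mul (hMB _ (hre z s hz hs.1)) (hMA _ (hre z (1 - s) hz (by linarith [hs.2])))
      (norm_nonneg _) hM
  refine ⟨?_, fun z hz => ?_⟩
  · refine aux_holo_integral _ _ (‖θ‖ * (M * M)) (fun z hz => ?_) ?_ ?_
    · apply ContinuousOn.aestronglyMeasurable _ measurableSet_Ioo
      refine θ.continuous.comp_continuousOn (ContinuousOn.clm_comp ?_ ?_)
      · exact B.holo.continuousOn.comp (f := fun s : ℝ => z * (s : ℂ)) (by fun_prop)
          (fun s hs => hre z s hz hs.1)
      · exact A.holo.continuousOn.comp (f := fun s : ℝ => z * ((1 - s : ℝ) : ℂ)) (by fun_prop)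
          (fun s hs => hre z (1 - s) hz (by linarith [hs.2]))
    · filter_upwards [ae_restrict_mem measurableSet_Ioo] with s hs
      refine θ.differentiable.comp_differentiableOn (DifferentiableOn.clm_comp ?_ ?_)
      · exact B.holo.comp (f := fun z : ℂ => z * (s : ℂ)) (by fun_prop)
          (fun z hz => hre z s hz hs.1)
      · exact A.holo.comp (f := fun z : ℂ => z * ((1 - s : ℝ) : ℂ)) (by fun_prop)
          (fun z hz => hre z (1 - s) hz (by linarith [hs.2]))
    · filter_upwards [ae_restrict_mem measurableSet_Ioo] with s hs
      exact hbd s hs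
  · have := norm_setIntegral_le_of_norm_le_const (μ := volume) (s := Set.Ioo (0 : ℝ) 1)
      (by simp) (fun s hs => hbd s hs z hz)
    simpa using this

end Holo
section Final
open Filter Topology

lemma aux_conv {μ : Measure ℝ} (hpos : ∀ᵐ u ∂μ, 0 < u) {E : Type*} [NormedAddCommGroup E]
    [NormedSpace ℝ E] (g : ℝ → E) :
    ∫ u, g u ∂(μ.withDensity (fun u => ENNReal.ofReal u)) = ∫ u, u • g u ∂μ := by
  rw [integral_withDensity_eq_integral_toReal_smul ENNReal.measurable_ofReal
    (ae_of_all _ fun _ => ENNReal.ofReal_lt_top)]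
  apply integral_congr_ae
  filter_upwards [hpos] with u hu
  rw [ENNReal.toReal_ofReal hu.le]

lemma aux_formula {tr : (X →L[ℂ] X) → ℂ}
    (htr_add : ∀ S R : X →L[ℂ] X, IsNuclear S → IsNuclear R → tr (S + R) = tr S + tr R)
    (htr_norm : ∀ S : X →L[ℂ] X, IsNuclear S → ‖tr S‖ ≤ nuclearNorm S)
    (htr_rank1 : ∀ (f : X →L[ℂ] ℂ) (y : X), tr (f.smulRight y) = f y)
    (A B : HoloGen X) {M : ℝ}
    (hMA : ∀ z : ℂ, 0 < z.re → ‖A.T z‖ ≤ M)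
    (hMB : ∀ z : ℂ, 0 < z.re → ‖B.T z‖ ≤ M)
    (hdom : A.dom = B.dom) (hdense : Dense (A.dom : Set X))
    (Δ : X →L[ℂ] X) (hΔ : ∀ x ∈ A.dom, Δ x = A.gen x - B.gen x)
    {f : ℕ → (X →L[ℂ] ℂ)} {y : ℕ → X}
    (hs : Summable (fun k => ‖f k‖ * ‖y k‖))
    (hΔs : ∀ x : X, HasSum (fun k => f k x • y k) (Δ x))
    {θ : (X →L[ℂ] X) →L[ℂ] ℂ} (hθ : ∀ R : X →L[ℂ] X, HasSum (fun k => f k (R (y k))) (θ R))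
    (μ : Measure ℝ) (hμ : μ {v : ℝ | v ≤ 0} = 0) (hμi : Integrable (fun v => v) μ)
    (D : X →L[ℂ] X) (hD : ∀ x ∈ A.dom, D x = ∫ u, (A.T (u : ℂ) x - B.T (u : ℂ) x) ∂μ) :
    tr D = ∫ u : ℝ, (∫ s in Set.Ioo (0 : ℝ) 1,
      θ ((B.T ((u : ℂ) * (s : ℂ))).comp (A.T ((u : ℂ) * ((1 - s : ℝ) : ℂ))))) * (u : ℂ) ∂μ := by
  have hM : 0 ≤ M := (norm_nonneg _).trans (hMA 1 (by simp))
  have hpos : ∀ᵐ u ∂μ, 0 < u := by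
    rw [ae_iff]
    simpa only [not_lt] using hμ
  set μ' : Measure ℝ := μ.withDensity (fun u => ENNReal.ofReal u) with hμ'
  have hfin : IsFiniteMeasure μ' := isFiniteMeasure_withDensity_ofReal hμi.2
  have hpos' : ∀ᵐ u ∂μ', u ∈ Set.Ioi (0 : ℝ) :=
    (withDensity_absolutelyContinuous μ _).ae_le hpos
  set S : Set (ℝ × ℝ) := Set.Ioi (0 : ℝ) ×ˢ Set.Ioo (0 : ℝ) 1 with hS
  have hSm : MeasurableSet S := measurableSet_Ioi.prod measurableSet_Ioo
  set ν : Measure (ℝ × ℝ) := μ'.prod (volume.restrict (Set.Ioo (0 : ℝ) 1)) with hν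
  have hνS : ν = (μ'.prod volume).restrict S := by
    rw [hS, ← Measure.prod_restrict, Measure.restrict_eq_self_of_ae_mem hpos']
  have hmem : ∀ᵐ p ∂ν, p ∈ S := by
    rw [hνS]
    exact ae_restrict_mem hSm
  set P : ℝ × ℝ → (X →L[ℂ] X) := fun p => A.T ((p.1 * (1 - p.2) : ℝ) : ℂ) with hP
  set Q : ℝ × ℝ → (X →L[ℂ] X) := fun p => B.T ((p.1 * p.2 : ℝ) : ℂ) with hQ
  have hPre : ∀ p ∈ S, 0 < (((p.1 * (1 - p.2) : ℝ) : ℂ)).re := by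
    rintro ⟨u, s⟩ ⟨hu, hs⟩
    rw [Complex.ofReal_re]
    exact mul_pos hu (by linarith [hs.2])
  have hQre : ∀ p ∈ S, 0 < (((p.1 * p.2 : ℝ) : ℂ)).re := by
    rintro ⟨u, s⟩ ⟨hu, hs⟩
    rw [Complex.ofReal_re]
    exact mul_pos hu hs.1
  have hPc : ContinuousOn P S :=
    A.holo.continuousOn.comp (f := fun p : ℝ × ℝ => ((p.1 * (1 - p.2) : ℝ) : ℂ))
      (by fun_prop) hPre
  have hQc : ContinuousOn Q S :=
    B.holo.continuousOn.comp (f := fun p : ℝ × ℝ => ((p.1 * p.2 : ℝ) : ℂ))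
      (by fun_prop) hQre
  have hPm : AEStronglyMeasurable P ν := by
    rw [hνS]; exact hPc.aestronglyMeasurable hSm
  have hQm : AEStronglyMeasurable Q ν := by
    rw [hνS]; exact hQc.aestronglyMeasurable hSm
  have hPM : ∀ᵐ p ∂ν, ‖P p‖ ≤ M := hmem.mono fun p hp => hMA _ (hPre p hp)
  have hQM : ∀ᵐ p ∂ν, ‖Q p‖ ≤ M := hmem.mono fun p hp => hMB _ (hQre p hp)
  have h1 := aux_core htr_add htr_norm htr_rank1 hs hΔs hθ ν hPm hQm hPM hQM
    (D := D) (A.dom : Set X) hdense (by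
      intro x hx
      rw [hD x hx]
      have hi : Integrable (fun p => P p (Δ (Q p x))) ν := by
        refine Integrable.mono' (integrable_const (M * (‖Δ‖ * (M * ‖x‖)))) ?_ ?_
        · rw [hνS]
          refine ContinuousOn.aestronglyMeasurable ?_ hSm
          exact hPc.clm_apply (Δ.continuous.comp_continuousOn
            (hQc.clm_apply continuousOn_const))
        · filter_upwards [hPM, hQM] with p h1 h2
          refine ((P p).le_of_opNorm_le h1 _).trans ?_
          refine mul_le_mul_of_nonneg_left ?_ hM
          exact Δ.le_opNorm_of_le ((Q p).le_of_opNorm_le h2 x)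
      rw [hν, integral_prod _ hi, aux_conv hpos]
      apply integral_congr_ae
      filter_upwards [hpos] with u hu
      exact aux_duhamel A B hMA hdom Δ hΔ hu x)
  have hi2 : Integrable (fun p => θ ((Q p).comp (P p))) ν := by
    refine Integrable.mono' (integrable_const (‖θ‖ * (M * M))) ?_ ?_
    · rw [hνS]
      refine ContinuousOn.aestronglyMeasurable ?_ hSm
      exact θ.continuous.comp_continuousOn (hQc.clm_comp hPc)
    · filter_upwards [hPM, hQM] with p h1 h2
      refine θ.le_opNorm_of_le ((opNorm_comp_le _ _).trans ?_)
      exact mul_le_mul h2 h1 (norm_nonneg _) hM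
  rw [h1, hν, integral_prod _ hi2, aux_conv hpos]
  congr 1
  ext u
  rw [Complex.real_smul, mul_comm]
  simp only [hP, hQ, Complex.ofReal_mul]

end Final

/-- **Theorem 8.** Let the Banach space `X` have the approximation property (so that
there is a trace `tr` on the ideal `𝔖₁` of nuclear operators: a functional which is
additive and homogeneous on nuclear operators, has norm `≤ 1` with respect to the
nuclear norm, and takes the value `f(y)` on the rank-one operator `x ↦ f(x) y`).
Let `A` and `B` be generators of `C₀`-semigroups `T_A`, `T_B` holomorphic in the half
plane `{Re z > 0}` with `‖T_A(z)‖, ‖T_B(z)‖ ≤ M` there.  If `A - B ∈ 𝔖₁` then there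
exists a unique tempered distribution `ξ` supported in `ℝ₊` such that for every
`ψ ∈ 𝒯₁` with `ψ'(-0) ≠ ∞`:
`tr(ψ(A) - ψ(B)) = ∫_{(0,∞)} ⟨ξ(t), e^{-ut}⟩ u dμ(u)`. -/
theorem trace_formula (hAP : ApproxProperty X)
    (tr : (X →L[ℂ] X) → ℂ)
    (htr_add : ∀ S R : X →L[ℂ] X, IsNuclear S → IsNuclear R → tr (S + R) = tr S + tr R)
    (htr_smul : ∀ (c : ℂ) (S : X →L[ℂ] X), IsNuclear S → tr (c • S) = c * tr S)
    (htr_norm : ∀ S : X →L[ℂ] X, IsNuclear S → ‖tr S‖ ≤ nuclearNorm S)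
    (htr_rank1 : ∀ (f : X →L[ℂ] ℂ) (y : X), tr (f.smulRight y) = f y)
    (A B : HoloGen X) (M : ℝ)
    (hMA : ∀ z : ℂ, 0 < z.re → ‖A.T z‖ ≤ M)
    (hMB : ∀ z : ℂ, 0 < z.re → ‖B.T z‖ ≤ M)
    (hdom : A.dom = B.dom) (hdense : Dense (A.dom : Set X))
    (Δ : X →L[ℂ] X) (hΔ : ∀ x ∈ A.dom, Δ x = A.gen x - B.gen x)
    (hΔnuc : IsNuclear Δ) :
    ∃ ξ : (ℝ → ℂ) → ℂ, IsTemperedDistRplus ξ ∧ TraceFormulaHolds tr A B ξ ∧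
      ∀ ξ' : (ℝ → ℂ) → ℂ, IsTemperedDistRplus ξ' → TraceFormulaHolds tr A B ξ' →
        ∀ φ ∈ TestSet, ξ' φ = ξ φ := by
  obtain ⟨f, y, hs, hΔs⟩ := hΔnuc
  obtain ⟨θ, hθ⟩ := aux_theta hs
  obtain ⟨hf, hK⟩ := aux_f A B hMA hMB θ
  obtain ⟨ξ, hξ, hξe⟩ := aux_exists_xi _ hf _ hK
  have hform : TraceFormulaHolds tr A B ξ := by
    intro μ hμ _ hμi D hD
    rw [aux_formula htr_add htr_norm htr_rank1 A B hMA hMB hdom hdense Δ hΔ hs hΔs hθ μ hμ hμi D hD]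
    have hpos : ∀ᵐ u ∂μ, 0 < u := by
      rw [ae_iff]
      simpa only [not_lt] using hμ
    apply integral_congr_ae
    filter_upwards [hpos] with u hu
    rw [hξe u hu]
  refine ⟨ξ, hξ, hform, fun ξ' hξ' hform' φ hφ => ?_⟩
  refine aux_unique hξ hξ' (fun u hu => ?_) hφ
  have hμ : Measure.dirac u {v : ℝ | v ≤ 0} = 0 := by
    have hms : MeasurableSet {v : ℝ | v ≤ 0} := measurableSet_Iic
    rw [Measure.dirac_apply' _ hms]
    simp [hu]
  have hIntegr : ∀ g : ℝ → ℝ, Integrable g (Measure.dirac u) := fun g => integrable_dirac (by simp)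
  have h1 := hform (Measure.dirac u) hμ (fun _ _ => hIntegr _) (hIntegr _)
    (A.T (u : ℂ) - B.T (u : ℂ)) (fun x _ => by rw [integral_dirac]; rfl)
  have h2 := hform' (Measure.dirac u) hμ (fun _ _ => hIntegr _) (hIntegr _)
    (A.T (u : ℂ) - B.T (u : ℂ)) (fun x _ => by rw [integral_dirac]; rfl)
  rw [integral_dirac] at h1 h2
  exact mul_right_cancel₀ (Complex.ofReal_ne_zero.2 hu.ne') (h2.symm.trans h1)
end
end
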